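/- arXiv:2312.01452 — 9 statements merged into one kernel-verified Lean document; each statement's English description precedes it below -/
import Mathlib

section
/- Let U ⊆ ℝ be an open interval and let f₀, f₁, …, f_p : U → ℝ be p+1 linearly independent real-analytic functions on U such that some f_j has constant sign on U (i.e. f_j(x) > 0 for all x ∈ U, or f_j(x) < 0 for all x ∈ U). Then there exist constants C₀, C₁, …, C_p ∈ ℝ such that the function f(x) = Σ_{i=0}^p C_i f_i(x) has at least p simple zeros in U, i.e. at least p points x ∈ U with f(x) = 0 and f'(x) ≠ 0. -/
theorem aux_points (p : ℕ) (U : Set ℝ) (f : Fin (p + 1) → ℝ → ℝ)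
    (hli : LinearIndependent ℝ (fun i => U.restrict (f i))) :
    ∃ x : Fin (p + 1) → ℝ, StrictMono x ∧ (∀ k, x k ∈ U) ∧
      ∀ w : Fin (p + 1) → ℝ, ∃ C : Fin (p + 1) → ℝ, ∀ k, ∑ i, C i * f i (x k) = w k := by
  classical
  let v : U → (Fin (p + 1) → ℝ) := fun x i => f i x
  have hspan : Submodule.span ℝ (Set.range v) = ⊤ := by
    by_contra hne
    obtain ⟨φ, hφ, hker⟩ := Submodule.exists_le_ker_of_lt_top _ (lt_top_iff_ne_top.2 hne)
    apply hφ
    have h0 : ∑ i, (φ (Pi.single i 1)) • (U.restrict (f i)) = 0 := by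
      funext x
      have h1 : φ (v x) = 0 := hker (Submodule.subset_span ⟨x, rfl⟩)
      rw [LinearMap.pi_apply_eq_sum_univ φ (v x)] at h1
      simp only [Finset.sum_apply, Pi.smul_apply, smul_eq_mul, Pi.zero_apply]
      rw [← h1]
      refine Finset.sum_congr rfl fun i _ => ?_
      have : (Pi.single i 1 : Fin (p + 1) → ℝ) = fun j => if i = j then 1 else 0 := by
        funext j; simp [Pi.single_apply, eq_comm]
      rw [this]
      exact mul_comm _ _
    have h2 := Fintype.linearIndependent_iff.1 hli _ h0
    refine LinearMap.pi_ext' fun i => LinearMap.ext_ring ?_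
    simpa using h2 i
  obtain ⟨κ, a, ha, hs, hl⟩ := exists_linearIndependent' ℝ v
  rw [hspan] at hs
  let b := Module.Basis.mk hl hs.ge
  let e0 : Fin (p + 1) ≃ κ := (Pi.basisFun ℝ (Fin (p + 1))).indexEquiv b
  let y : Fin (p + 1) → ℝ := fun k => a (e0 k)
  have hy : Function.Injective y := by
    intro k l h
    exact e0.injective (ha (Subtype.ext h))
  refine ⟨y ∘ Tuple.sort y, (Tuple.monotone_sort y).strictMono_of_injective
    (hy.comp (Tuple.sort y).injective), fun k => (a _).2, fun w => ?_⟩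
  let e : Fin (p + 1) ≃ κ := (Tuple.sort y).trans e0
  let φ := b.constr ℝ (fun k => w (e.symm k))
  refine ⟨fun i => φ (Pi.single i 1), fun k => ?_⟩
  have h1 : φ (b (e k)) = w k := by
    rw [Module.Basis.constr_basis]; simp
  have h2 : b (e k) = v (a (e k)) := by simp [b]
  rw [h2, LinearMap.pi_apply_eq_sum_univ φ] at h1
  rw [← h1]
  refine Finset.sum_congr rfl fun i _ => ?_
  have : (Pi.single i 1 : Fin (p + 1) → ℝ) = fun j => if i = j then 1 else 0 := by
    funext j; simp [Pi.single_apply, eq_comm]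
  beta_reduce
  rw [this]
  exact mul_comm _ _

theorem aux_sard (U : Set ℝ) (h h' : ℝ → ℝ) (hd : ∀ x ∈ U, HasDerivAt h (h' x) x) :
    ∃ c ∈ Set.Ioo (-1 : ℝ) 1, ∀ x ∈ U, h x = c → h' x ≠ 0 := by
  have h0 : MeasureTheory.volume (h '' {x | x ∈ U ∧ h' x = 0}) = 0 := by
    refine MeasureTheory.addHaar_image_eq_zero_of_det_fderivWithin_eq_zero
      MeasureTheory.volume (f' := fun x => ContinuousLinearMap.toSpanSingleton ℝ (h' x)) ?_ ?_
    · intro x hx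
      exact (hd x hx.1).hasFDerivAt.hasFDerivWithinAt
    · intro x hx
      rw [hx.2]; simp
  by_contra! hcon
  have hsub : Set.Ioo (-1 : ℝ) 1 ⊆ h '' {x | x ∈ U ∧ h' x = 0} := by
    intro c hc
    obtain ⟨x, hx, hxc, hx0⟩ := hcon c hc
    exact ⟨x, ⟨hx, hx0⟩, hxc⟩
  have := MeasureTheory.measure_mono_null hsub h0
  rw [Real.volume_Ioo] at this
  norm_num at this

theorem exists_combination_with_p_simple_zeros
    (p : ℕ) (a b : ℝ) (hab : a < b) (f : Fin (p + 1) → ℝ → ℝ)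
    (hana : ∀ i, AnalyticOn ℝ (f i) (Set.Ioo a b))
    (hli : LinearIndependent ℝ (fun i => (Set.Ioo a b).restrict (f i)))
    (hsign : ∃ j, (∀ x ∈ Set.Ioo a b, 0 < f j x) ∨ (∀ x ∈ Set.Ioo a b, f j x < 0)) :
    ∃ C : Fin (p + 1) → ℝ, ∃ z : Fin p → ℝ, Function.Injective z ∧
      ∀ j : Fin p, z j ∈ Set.Ioo a b ∧
        (∑ i, C i * f i (z j)) = 0 ∧
        deriv (fun x => ∑ i, C i * f i x) (z j) ≠ 0 := by
  classical
  obtain ⟨j, hj⟩ := hsign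
  have hj0 : ∀ x ∈ Set.Ioo a b, f j x ≠ 0 := by
    intro x hx
    rcases hj with h | h
    · exact (h x hx).ne'
    · exact (h x hx).ne
  have hdf : ∀ i, ∀ x ∈ Set.Ioo a b, HasDerivAt (f i) (deriv (f i) x) x := fun i x hx =>
    (((hana i).differentiableOn x hx).differentiableAt (isOpen_Ioo.mem_nhds hx)).hasDerivAt
  obtain ⟨x, hx, hxU, hw⟩ := aux_points p _ f hli
  obtain ⟨C, hC⟩ := hw (fun k => (-1) ^ (k : ℕ) * f j (x k))
  have hdF : ∀ D : Fin (p + 1) → ℝ, ∀ y ∈ Set.Ioo a b,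
      HasDerivAt (fun x => ∑ i, D i * f i x) (∑ i, D i * deriv (f i) y) y := fun D y hy =>
    HasDerivAt.fun_sum fun i _ => (hdf i y hy).const_mul (D i)
  let h : ℝ → ℝ := fun y => (∑ i, C i * f i y) / f j y
  have hdh : ∀ y ∈ Set.Ioo a b, HasDerivAt h
      (((∑ i, C i * deriv (f i) y) * f j y - (∑ i, C i * f i y) * deriv (f j) y) / f j y ^ 2) y :=
    fun y hy => (hdF C y hy).fun_div (hdf j y hy) (hj0 y hy)
  obtain ⟨c, hc, hreg⟩ := aux_sard _ h _ hdh
  have hxk : ∀ k, h (x k) = (-1) ^ (k : ℕ) := fun k => by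
    simp only [h, hC]
    exact mul_div_cancel_right₀ _ (hj0 _ (hxU k))
  have hne : ∀ k, h (x k) ≠ c := by
    intro k hk
    rw [hxk] at hk
    rcases neg_one_pow_eq_or ℝ (k : ℕ) with h1 | h1 <;> rw [h1] at hk <;>
      linarith [hc.1, hc.2]
  have hz : ∀ k : Fin p, ∃ z ∈ Set.Ioo (x k.castSucc) (x k.succ), h z = c := by
    intro k
    have hlt : x k.castSucc < x k.succ := hx k.castSucc_lt_succ
    have hsub : Set.Icc (x k.castSucc) (x k.succ) ⊆ Set.Ioo a b := fun y hy =>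
      ⟨(hxU _).1.trans_le hy.1, hy.2.trans_lt (hxU _).2⟩
    have hcont : ContinuousOn h (Set.uIcc (x k.castSucc) (x k.succ)) := by
      rw [Set.uIcc_of_le hlt.le]
      exact fun y hy => (hdh y (hsub hy)).continuousAt.continuousWithinAt
    have hmem : c ∈ Set.uIcc (h (x k.castSucc)) (h (x k.succ)) := by
      rw [hxk, hxk, Set.mem_uIcc, Fin.val_succ, Fin.val_castSucc, pow_succ]
      rcases neg_one_pow_eq_or ℝ (k : ℕ) with h1 | h1 <;> rw [h1]
      · right; constructor <;> linarith [hc.1, hc.2]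
      · left; constructor <;> linarith [hc.1, hc.2]
    obtain ⟨z, hz, hzc⟩ := intermediate_value_uIcc hcont hmem
    rw [Set.uIcc_of_le hlt.le] at hz
    refine ⟨z, ⟨lt_of_le_of_ne hz.1 ?_, lt_of_le_of_ne hz.2 ?_⟩, hzc⟩
    · rintro rfl; exact hne _ hzc
    · rintro rfl; exact hne _ hzc
  choose z hzI hzc using hz
  have hzU : ∀ k, z k ∈ Set.Ioo a b := fun k =>
    ⟨(hxU _).1.trans (hzI k).1, (hzI k).2.trans (hxU _).2⟩
  have hmono : StrictMono z := by
    intro k l hkl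
    have : x k.succ ≤ x l.castSucc := hx.monotone (by
      rw [Fin.le_def, Fin.val_succ, Fin.val_castSucc]; exact hkl)
    exact (hzI k).2.trans_le (this.trans (hzI l).1.le)
  have hsum : ∀ g : Fin (p + 1) → ℝ,
      ∑ i, (C i - if i = j then c else 0) * g i = ∑ i, C i * g i - c * g j := by
    intro g
    simp [sub_mul, Finset.sum_sub_distrib]
  refine ⟨fun i => C i - if i = j then c else 0, z, hmono.injective, fun k => ⟨hzU k, ?_, ?_⟩⟩
  · have h1 := hzc k
    simp only [h] at h1
    rw [div_eq_iff (hj0 _ (hzU k))] at h1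
    rw [hsum (fun i => f i (z k)), h1, sub_self]
  · rw [(hdF _ _ (hzU k)).deriv, hsum (fun i => deriv (f i) (z k))]
    intro h0
    have h1 := hzc k
    simp only [h] at h1
    rw [div_eq_iff (hj0 _ (hzU k))] at h1
    apply hreg _ (hzU k) (hzc k)
    rw [h1, sub_eq_zero.1 h0]
    ring
end

section
/- Let R₂, R₃, R₄, R₅ : ℝ → ℝ be continuous functions and for a continuous f write f̃(θ) = ∫₀^θ f(s) ds. Define u₂(θ) = R̃₂(θ); u₃(θ) = (R̃₂(θ))² + R̃₃(θ); u₄(θ) = (R̃₂(θ))³ + 3R̃₂(θ)R̃₃(θ) − ∫₀^θ R̃₃(s)R₂(s) ds + R̃₄(θ); and u₅(θ) = (R̃₂(θ))⁴ + 5(R̃₂(θ))²R̃₃(θ) + ∫₀^θ (R̃₂(s))² R₃(s) ds − 2R̃₂(θ)·∫₀^θ R̃₃(s)R₂(s) ds + (3/2)(R̃₃(θ))² + 4R̃₂(θ)R̃₄(θ) − 2∫₀^θ R̃₄(s)R₂(s) ds + R̃₅(θ). Then u₂, u₃, u₄, u₅ are differentiable, vanish at θ = 0, and satisfy for all θ ∈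 ℝ the hierarchy u₂' = R₂, u₃' = R₃ + 2R₂u₂, u₄' = R₄ + 3R₃u₂ + R₂(u₂² + 2u₃), and u₅' = R₅ + 4R₄u₂ + 3R₃(u₂² + u₃) + 2R₂(u₂u₃ + u₄). -/
/-- The functions `u₂,…,u₅` built from iterated integrals of `R₂,…,R₅` vanish at
`0` and satisfy the hierarchy of linear differential equations obtained by
matching powers of `ρ` in `dr/dθ = ∑_{k≥2} R_k(θ) r^k`. -/
theorem u_hierarchy
    (R2 R3 R4 R5 : ℝ → ℝ)
    (hc2 : Continuous R2) (hc3 : Continuous R3)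
    (hc4 : Continuous R4) (hc5 : Continuous R5)
    (u2 u3 u4 u5 : ℝ → ℝ)
    (hu2 : ∀ θ : ℝ, u2 θ = ∫ s in (0:ℝ)..θ, R2 s)
    (hu3 : ∀ θ : ℝ, u3 θ = (∫ s in (0:ℝ)..θ, R2 s) ^ 2 + ∫ s in (0:ℝ)..θ, R3 s)
    (hu4 : ∀ θ : ℝ, u4 θ = (∫ s in (0:ℝ)..θ, R2 s) ^ 3
      + 3 * (∫ s in (0:ℝ)..θ, R2 s) * (∫ s in (0:ℝ)..θ, R3 s)
      - (∫ s in (0:ℝ)..θ, (∫ t in (0:ℝ)..s, R3 t) * R2 s)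
      + ∫ s in (0:ℝ)..θ, R4 s)
    (hu5 : ∀ θ : ℝ, u5 θ = (∫ s in (0:ℝ)..θ, R2 s) ^ 4
      + 5 * (∫ s in (0:ℝ)..θ, R2 s) ^ 2 * (∫ s in (0:ℝ)..θ, R3 s)
      + (∫ s in (0:ℝ)..θ, (∫ t in (0:ℝ)..s, R2 t) ^ 2 * R3 s)
      - 2 * (∫ s in (0:ℝ)..θ, R2 s) * (∫ s in (0:ℝ)..θ, (∫ t in (0:ℝ)..s, R3 t) * R2 s)
      + (3 / 2) * (∫ s in (0:ℝ)..θ, R3 s) ^ 2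
      + 4 * (∫ s in (0:ℝ)..θ, R2 s) * (∫ s in (0:ℝ)..θ, R4 s)
      - 2 * (∫ s in (0:ℝ)..θ, (∫ t in (0:ℝ)..s, R4 t) * R2 s)
      + ∫ s in (0:ℝ)..θ, R5 s) :
    u2 0 = 0 ∧ u3 0 = 0 ∧ u4 0 = 0 ∧ u5 0 = 0 ∧
    ∀ θ : ℝ,
      HasDerivAt u2 (R2 θ) θ ∧
      HasDerivAt u3 (R3 θ + 2 * R2 θ * u2 θ) θ ∧
      HasDerivAt u4 (R4 θ + 3 * R3 θ * u2 θ + R2 θ * ((u2 θ) ^ 2 + 2 * u3 θ)) θ ∧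
      HasDerivAt u5 (R5 θ + 4 * R4 θ * u2 θ + 3 * R3 θ * ((u2 θ) ^ 2 + u3 θ)
        + 2 * R2 θ * (u2 θ * u3 θ + u4 θ)) θ := by
  have ftc : ∀ f : ℝ → ℝ, Continuous f → ∀ θ : ℝ,
      HasDerivAt (fun x : ℝ => ∫ s in (0:ℝ)..x, f s) (f θ) θ := fun f hf θ =>
    intervalIntegral.integral_hasDerivAt_right (hf.intervalIntegrable _ _)
      hf.stronglyMeasurable.stronglyMeasurableAtFilter hf.continuousAt
  have cont : ∀ f : ℝ → ℝ, Continuous f →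
      Continuous (fun x : ℝ => ∫ s in (0:ℝ)..x, f s) := fun f hf =>
    continuous_iff_continuousAt.2 fun x => (ftc f hf x).continuousAt
  refine ⟨by simp [hu2], by simp [hu3], by simp [hu4], by simp [hu5], fun θ => ?_⟩
  have h2 := ftc R2 hc2 θ
  have h3 := ftc R3 hc3 θ
  have h4 := ftc R4 hc4 θ
  have h5 := ftc R5 hc5 θ
  have h32 := ftc _ ((cont R3 hc3).mul hc2) θ
  have h42 := ftc _ ((cont R4 hc4).mul hc2) θ
  have h23 := ftc _ (((cont R2 hc2).pow 2).mul hc3) θ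
  refine ⟨?_, ?_, ?_, ?_⟩
  · rw [funext hu2]
    exact h2
  · rw [hu2, funext hu3]
    refine ((h2.pow 2).add h3).congr_deriv ?_
    push_cast
    ring
  · rw [hu2, hu3, funext hu4]
    refine ((((h2.pow 3).add ((h2.const_mul 3).mul h3)).sub h32).add h4).congr_deriv ?_
    simp only [Pi.pow_apply, Pi.mul_apply]
    push_cast
    ring
  · rw [hu2, hu3, hu4, funext hu5]
    refine ((((((((h2.pow 4).add (((h2.pow 2).const_mul 5).mul h3)).add h23).sub
      ((h2.const_mul 2).mul h32)).add ((h3.pow 2).const_mul (3 / 2))).add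
      ((h2.const_mul 4).mul h4)).sub (h42.const_mul 2)).add h5).congr_deriv ?_
    simp only [Pi.pow_apply, Pi.mul_apply]
    push_cast
    ring
end

section
/- Let λ ∈ ℝ and A, B ∈ ℂ. Then ∫₀^π e^{2λθ} ( Re(B e^{2iθ}) − Re(A e^{iθ}) Im(A e^{iθ}) − λ Im(B e^{2iθ}) + λ (Im(A e^{iθ}))² ) dθ = (e^{2λπ} − 1) · ( Re( (1 + λi)B / (2(i + λ)) + A·conj(A)/4 ) − Im( (1 + λi)A² / (4(i + λ)) ) ). -/
open Complex

/-- The integral `R̃₃(π)` appearing in the third coefficient of the half-return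
map of `ż = (λ+i)z + Az² + Bz³ + O(z⁴)`. -/
theorem integral_R3_tilde_pi (l : ℝ) (A B : ℂ) :
    ∫ θ in (0:ℝ)..Real.pi,
        Real.exp (2 * l * θ) *
          ((B * Complex.exp (2 * Complex.I * θ)).re
            - (A * Complex.exp (Complex.I * θ)).re * (A * Complex.exp (Complex.I * θ)).im
            - l * (B * Complex.exp (2 * Complex.I * θ)).im
            + l * ((A * Complex.exp (Complex.I * θ)).im) ^ 2)
      = (Real.exp (2 * l * Real.pi) - 1) *
          ((((1 + (l : ℂ) * Complex.I) * B / (2 * (Complex.I + (l : ℂ)))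
              + A * (starRingEnd ℂ) A / 4).re)
            - (((1 + (l : ℂ) * Complex.I) * A ^ 2 / (4 * (Complex.I + (l : ℂ)))).im)) := by
  have hne : Complex.I + (l : ℂ) ≠ 0 := by
    intro h
    have := congrArg Complex.im h
    simp at this
  set P : ℂ := (1 + (l : ℂ) * Complex.I) * B / (2 * (Complex.I + (l : ℂ))) with hP
  set Q : ℂ := (1 + (l : ℂ) * Complex.I) * A ^ 2 / (4 * (Complex.I + (l : ℂ))) with hQ
  have eP : 2 * (Complex.I + (l : ℂ)) * P = (1 + (l : ℂ) * Complex.I) * B := by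
    rw [hP]; field_simp
  have eQ : 4 * (Complex.I + (l : ℂ)) * Q = (1 + (l : ℂ) * Complex.I) * A ^ 2 := by
    rw [hQ]; field_simp
  clear_value P Q
  have eP1 := congrArg Complex.re eP
  have eP2 := congrArg Complex.im eP
  have eQ1 := congrArg Complex.re eQ
  have eQ2 := congrArg Complex.im eQ
  simp [pow_two] at eP1 eP2 eQ1 eQ2
  have hd : ∀ θ : ℝ, HasDerivAt (fun θ : ℝ => Real.exp (2 * l * θ) *
      (P.re * Real.cos (2 * θ) - P.im * Real.sin (2 * θ) + (A.re ^ 2 + A.im ^ 2) / 4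
        - (Q.re * Real.sin (2 * θ) + Q.im * Real.cos (2 * θ))))
      (Real.exp (2 * l * θ) *
          ((B * Complex.exp (2 * Complex.I * θ)).re
            - (A * Complex.exp (Complex.I * θ)).re * (A * Complex.exp (Complex.I * θ)).im
            - l * (B * Complex.exp (2 * Complex.I * θ)).im
            + l * ((A * Complex.exp (Complex.I * θ)).im) ^ 2)) θ := by
    intro θ
    have h2 : HasDerivAt (fun θ : ℝ => 2 * θ) 2 θ := by
      simpa using (hasDerivAt_id θ).const_mul 2
    have hl : HasDerivAt (fun θ : ℝ => 2 * l * θ) (2 * l) θ := by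
      simpa using (hasDerivAt_id θ).const_mul (2 * l)
    have H := hl.exp.mul ((((h2.cos.const_mul P.re).sub (h2.sin.const_mul P.im)).add_const
      ((A.re ^ 2 + A.im ^ 2) / 4)).sub ((h2.sin.const_mul Q.re).add (h2.cos.const_mul Q.im)))
    refine H.congr_deriv ?_
    simp [Complex.exp_re, Complex.exp_im]
    rw [mul_assoc, ← mul_add]
    congr 1
    have hc := Real.cos_sq_add_sin_sq θ
    rw [Real.cos_two_mul, Real.sin_two_mul]
    set c := Real.cos θ
    set s := Real.sin θ
    have hs : s ^ 2 = 1 - c ^ 2 := by linarith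
    linear_combination (2*c^2-1)*eP1 - (2*s*c)*eP2 - (2*s*c)/2*eQ1 - (2*c^2-1)/2*eQ2 + (-l*A.re^2 - A.re*A.im)*hs
  rw [intervalIntegral.integral_eq_sub_of_hasDerivAt (fun θ _ => hd θ)
    (Continuous.intervalIntegrable (by fun_prop) _ _)]
  simp
  ring
end

section
/- Let k ≥ 1 and m ≥ 1 be integers, δ > 0, and let D : [0, δ] × ℝ^m → ℝ be such that for each s ∈ ℝ^m the map r ↦ D(r, s) is (k−1) times differentiable on [0, δ], the partial derivative ∂_r^{k−1} D is jointly continuous on [0, δ] × ℝ^m, and ∂_r^{k−1} D(0, 0) ≠ 0. Then there exist ε > 0 and ρ > 0 such that for every s ∈ ℝ^m with ‖s‖ < ρ, the function r ↦ D(r, s) has at most k−1 zeros in [0, ε]. -/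
theorem rolle_iter (δ ε : ℝ) (hε : ε ≤ δ) (hδ : 0 < δ) (n : ℕ) : ∀ (f : ℝ → ℝ),
    ContDiffOn ℝ n f (Set.Icc 0 δ) → ∀ x : Fin (n + 1) → ℝ, StrictMono x →
    (∀ i, x i ∈ Set.Icc 0 ε) → (∀ i, f (x i) = 0) →
    ∃ c ∈ Set.Icc 0 ε, iteratedDerivWithin n f (Set.Icc 0 δ) c = 0 := by
  induction n with
  | zero =>
    intro f _ x _ hx h0
    exact ⟨x 0, hx 0, by simpa using h0 0⟩
  | succ n ih =>
    intro f hf x hmono hx h0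
    have hu : UniqueDiffOn ℝ (Set.Icc 0 δ) := uniqueDiffOn_Icc hδ
    have hf' : ContDiffOn ℝ n (derivWithin f (Set.Icc 0 δ)) (Set.Icc 0 δ) :=
      hf.derivWithin hu (by norm_cast)
    have key : ∀ i : Fin (n + 1), ∃ c ∈ Set.Ioo (x i.castSucc) (x i.succ),
        derivWithin f (Set.Icc 0 δ) c = 0 := by
      intro i
      have hlt : x i.castSucc < x i.succ := hmono i.castSucc_lt_succ
      have h1 := (hx i.castSucc).1
      have h2 := (hx i.succ).2
      obtain ⟨c, hc, hc0⟩ := exists_deriv_eq_zero hlt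
        (hf.continuousOn.mono (Set.Icc_subset_Icc h1 (h2.trans hε)))
        ((h0 _).trans (h0 _).symm)
      refine ⟨c, hc, ?_⟩
      rw [derivWithin_of_mem_nhds, hc0]
      exact Icc_mem_nhds (h1.trans_lt hc.1) (hc.2.trans_le (h2.trans hε))
    choose y hy hy0 using key
    obtain ⟨c, hc, hc0⟩ := ih _ hf' y
      (by
        intro i j hij
        have : x i.succ ≤ x j.castSucc := hmono.monotone (by
          rw [Fin.le_def]; simpa using hij)
        exact (hy i).2.trans_le (this.trans (hy j).1.le))
      (fun i => ⟨(hx i.castSucc).1.trans (hy i).1.le, (hy i).2.le.trans (hx i.succ).2⟩)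
      hy0
    exact ⟨c, hc, by rw [iteratedDerivWithin_succ']; exact hc0⟩

/-- Rolle-type finiteness: if `∂_r^{k-1} D` is jointly continuous on
`[0,δ] × ℝ^m` and nonzero at `(0,0)`, then for all small `s` the function
`r ↦ D(r,s)` has at most `k-1` zeros on a small interval `[0,ε]`. -/
theorem at_most_k_minus_one_zeros
    (k m : ℕ) (hk : 1 ≤ k) (hm : 1 ≤ m) (δ : ℝ) (hδ : 0 < δ)
    (D : ℝ → (Fin m → ℝ) → ℝ)
    (hdiff : ∀ s : Fin m → ℝ, ContDiffOn ℝ (k - 1 : ℕ) (fun r => D r s) (Set.Icc 0 δ))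
    (hcont : ContinuousOn
      (fun p : ℝ × (Fin m → ℝ) =>
        iteratedDerivWithin (k - 1) (fun r => D r p.2) (Set.Icc 0 δ) p.1)
      (Set.Icc 0 δ ×ˢ (Set.univ : Set (Fin m → ℝ))))
    (hne : iteratedDerivWithin (k - 1) (fun r => D r 0) (Set.Icc 0 δ) 0 ≠ 0) :
    ∃ ε > 0, ∃ ρ > 0, ∀ s : Fin m → ℝ, ‖s‖ < ρ →
      ({r : ℝ | r ∈ Set.Icc 0 ε ∧ D r s = 0}).encard ≤ (k - 1 : ℕ) := by
  have h00 : ((0 : ℝ), (0 : Fin m → ℝ)) ∈ Set.Icc 0 δ ×ˢ (Set.univ : Set (Fin m → ℝ)) :=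
    ⟨⟨le_rfl, hδ.le⟩, trivial⟩
  have hev := (hcont _ h00).eventually_ne hne
  obtain ⟨η, hη, hball⟩ := Metric.mem_nhdsWithin_iff.1 hev
  refine ⟨min δ (η / 2), by positivity, η, hη, fun s hs => ?_⟩
  by_contra hcon
  have hle : ((k - 1 + 1 : ℕ) : ℕ∞) ≤
      ({r : ℝ | r ∈ Set.Icc 0 (min δ (η / 2)) ∧ D r s = 0}).encard := by
    push_cast
    exact Order.add_one_le_of_lt (not_le.1 hcon)
  obtain ⟨t, ht, htc⟩ := Set.exists_subset_encard_eq hle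
  have hfin : t.Finite := Set.finite_of_encard_eq_coe htc
  have hcard : hfin.toFinset.card = k - 1 + 1 := by
    rw [hfin.encard_eq_coe_toFinset_card] at htc
    exact_mod_cast htc
  have hmem : ∀ i, hfin.toFinset.orderEmbOfFin hcard i ∈ t := fun i =>
    hfin.mem_toFinset.1 (Finset.orderEmbOfFin_mem _ hcard i)
  obtain ⟨c, hc, hc0⟩ := rolle_iter δ (min δ (η / 2)) (min_le_left _ _) hδ (k - 1) _ (hdiff s)
    (hfin.toFinset.orderEmbOfFin hcard) (OrderEmbedding.strictMono _)
    (fun i => (ht (hmem i)).1) (fun i => (ht (hmem i)).2)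
  have h1 : c ≤ δ := hc.2.trans (min_le_left _ _)
  have h2 : c ≤ η / 2 := hc.2.trans (min_le_right _ _)
  have := @hball (c, s) ⟨by
    rw [Metric.mem_ball, Prod.dist_eq]
    refine max_lt ?_ (by simpa using hs)
    simp only [Real.dist_eq, sub_zero, abs_of_nonneg hc.1]
    linarith, ⟨hc.1, h1⟩, trivial⟩
  exact this hc0
end

section
/- Let n ≥ 1 be an integer, let a₀, a₁, …, a_n and b₀, b₁, …, b_n be real numbers, and let r ∈ ℝ. Then ∫₀^π [ a₁ r + a₀ cos θ + b₀ sin θ + Σ_{k=1}^{n−1} r^{k+1} ( a_{k+1} cos(kθ) − b_{k+1} sin(kθ) ) ] dθ = 2b₀ + π a₁ r − 2 Σ_{m=1}^{⌊n/2⌋} ( b_{2m} / (2m−1) ) r^{2m}. -/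
open Real

lemma aux_term (k : ℕ) (hk : 1 ≤ k) (c A B : ℝ) :
    (∫ θ in (0:ℝ)..π, c * (A * Real.cos (k * θ) - B * Real.sin (k * θ)))
      = - (c * B * ((1 - (-1) ^ k) / k)) := by
  have hk0 : (k : ℝ) ≠ 0 := by positivity
  have hd : ∀ x ∈ Set.uIcc (0:ℝ) π, HasDerivAt
      (fun θ : ℝ => c * (A * (Real.sin (k * θ) / k) + B * (Real.cos (k * θ) / k)))
      (c * (A * Real.cos (k * x) - B * Real.sin (k * x))) x := by
    intro x _
    have h1 : HasDerivAt (fun θ : ℝ => (k : ℝ) * θ) k x := by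
      simpa using (hasDerivAt_id x).const_mul (k : ℝ)
    have h2 := (((h1.sin.div_const (k : ℝ)).const_mul A).add
      ((h1.cos.div_const (k : ℝ)).const_mul B)).const_mul c
    refine h2.congr_deriv ?_
    field_simp
    ring
  rw [intervalIntegral.integral_eq_sub_of_hasDerivAt hd
    (Continuous.intervalIntegrable (by fun_prop) _ _)]
  simp only [Real.sin_nat_mul_pi, Real.cos_nat_mul_pi, mul_zero, Real.sin_zero, Real.cos_zero]
  field_simp
  ring

lemma aux_sum (b : ℕ → ℝ) (r : ℝ) (N : ℕ) :
    ∑ k ∈ Finset.Icc 1 N, (r ^ (k + 1) * b (k + 1) * ((1 - (-1) ^ k) / (k : ℝ)))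
      = 2 * ∑ m ∈ Finset.Icc 1 ((N + 1) / 2), (b (2 * m) / (2 * (m : ℝ) - 1)) * r ^ (2 * m) := by
  induction N with
  | zero => simp
  | succ N ih =>
    rw [Finset.sum_Icc_succ_top (by omega), ih]
    rcases Nat.even_or_odd' N with ⟨j, rfl | rfl⟩
    · have e1 : (2 * j + 1) / 2 = j := by omega
      have e2 : (2 * j + 1 + 1) / 2 = j + 1 := by omega
      rw [e1, e2, Finset.sum_Icc_succ_top (by omega)]
      have h : (-1 : ℝ) ^ (2 * j + 1) = -1 := Odd.neg_one_pow ⟨j, rfl⟩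
      have e3 : 2 * (j + 1) = 2 * j + 1 + 1 := by ring
      have e4 : (2 * ((j + 1 : ℕ) : ℝ) - 1) = ((2 * j + 1 : ℕ) : ℝ) := by push_cast; ring
      rw [h, e3, e4]
      ring
    · have e1 : (2 * j + 1 + 1) / 2 = j + 1 := by omega
      have e2 : (2 * j + 1 + 1 + 1) / 2 = j + 1 := by omega
      have h : (-1 : ℝ) ^ (2 * j + 1 + 1) = 1 := Even.neg_one_pow ⟨j + 1, by ring⟩
      rw [e1, e2, h]
      simp

/-- Computation of the first averaged function
`M₁⁺(r) = ∫₀^π F₁(θ,r) dθ = 2b₀ + π a₁ r − 2 ∑_{m=1}^{⌊n/2⌋} b_{2m} r^{2m}/(2m−1)`. -/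
theorem first_averaged_function
    (n : ℕ) (hn : 1 ≤ n) (a b : ℕ → ℝ) (r : ℝ) :
    (∫ θ in (0:ℝ)..π,
        (a 1 * r + a 0 * Real.cos θ + b 0 * Real.sin θ
          + ∑ k ∈ Finset.Icc 1 (n - 1),
              r ^ (k + 1) * (a (k + 1) * Real.cos (k * θ) - b (k + 1) * Real.sin (k * θ))))
      = 2 * b 0 + π * a 1 * r
        - 2 * ∑ m ∈ Finset.Icc 1 (n / 2), (b (2 * m) / (2 * (m : ℝ) - 1)) * r ^ (2 * m) := by
  obtain ⟨N, rfl⟩ : ∃ N, n = N + 1 := ⟨n - 1, by omega⟩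
  rw [Nat.add_sub_cancel, ← aux_sum]
  rw [intervalIntegral.integral_add (Continuous.intervalIntegrable (by fun_prop) _ _)
      (Continuous.intervalIntegrable (by fun_prop) _ _),
    intervalIntegral.integral_add (Continuous.intervalIntegrable (by fun_prop) _ _)
      (Continuous.intervalIntegrable (by fun_prop) _ _),
    intervalIntegral.integral_add (Continuous.intervalIntegrable (by fun_prop) _ _)
      (Continuous.intervalIntegrable (by fun_prop) _ _),
    intervalIntegral.integral_finsetSum
      (fun k _ => Continuous.intervalIntegrable (by fun_prop) _ _),
    Finset.sum_congr rfl (fun k hk => aux_term k (Finset.mem_Icc.1 hk).1 _ _ _),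
    Finset.sum_neg_distrib]
  simp only [intervalIntegral.integral_const, intervalIntegral.integral_const_mul,
    integral_cos, integral_sin, Real.sin_pi, Real.cos_pi, Real.sin_zero, Real.cos_zero,
    smul_eq_mul]
  ring
end

section
/- Define e₁(u,v) = 1666 sin(u) cos(v) + (245(cos(u) − e^{−u/5}) − 385 sin(u)) sin(v) − 1666 sin(u) e^{−3v/8} and e₂(u,v) = (−245(cos(u) − e^{−u/5}) + 385 sin(u)) cos(v) + 1666 sin(u) sin(v) + (−385 sin(u) − 245 cos(u) + 245 e^{u/5}) e^{−3v/8}. Then on the rectangle B₁ = [17/5, 139/40] × [7/5, 41/25] the following sign conditions hold: e₁(17/5, v) < 0 and e₁(139/40, v) > 0 for all v ∈ [7/5, 41/25], and e₂(u, 7/5) > 0 and e₂(u, 41/25) < 0 for all u ∈ [17/5, 139/40]. -/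
open Real

/-- The function `e₁(u,v)` from the Poincaré–Miranda proof of the existence of
three limit cycles. -/
noncomputable def e1 (u v : ℝ) : ℝ :=
  1666 * Real.sin u * Real.cos v
    + (245 * (Real.cos u - Real.exp (-u / 5)) - 385 * Real.sin u) * Real.sin v
    - 1666 * Real.sin u * Real.exp (-3 * v / 8)

/-- The function `e₂(u,v)` from the Poincaré–Miranda proof of the existence of
three limit cycles. -/
noncomputable def e2 (u v : ℝ) : ℝ :=
  (-245 * (Real.cos u - Real.exp (-u / 5)) + 385 * Real.sin u) * Real.cos v
    + 1666 * Real.sin u * Real.sin v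
    + (-385 * Real.sin u - 245 * Real.cos u + 245 * Real.exp (u / 5)) * Real.exp (-3 * v / 8)

theorem trig_bd (x : ℝ) (h0 : 0 ≤ x) (h1 : x ≤ 4) :
    |Real.cos x - (1 - x^2/2 + x^4/24 - x^6/720 + x^8/40320 - x^10/3628800 + x^12/479001600
      - x^14/87178291200 + x^16/20922789888000 - x^18/6402373705728000)|
      ≤ x^20 / 2432902008176640000 * 2 ∧
    |Real.sin x - (x - x^3/6 + x^5/120 - x^7/5040 + x^9/362880 - x^11/39916800
      + x^13/6227020800 - x^15/1307674368000 + x^17/355687428096000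
      - x^19/121645100408832000)|
      ≤ x^20 / 2432902008176640000 * 2 := by
  have hn : ‖(x : ℂ) * Complex.I‖ = x := by
    simp [abs_of_nonneg h0]
  have hb := Complex.exp_bound' (x := (x : ℂ) * Complex.I) (n := 20) (by
    rw [hn]; norm_num; linarith)
  rw [hn] at hb
  have hs : Complex.exp ((x : ℂ) * Complex.I)
      - ∑ m ∈ Finset.range 20, ((x : ℂ) * Complex.I) ^ m / (m.factorial : ℂ)
      = ((Real.cos x - (1 - x^2/2 + x^4/24 - x^6/720 + x^8/40320 - x^10/3628800 + x^12/479001600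
      - x^14/87178291200 + x^16/20922789888000 - x^18/6402373705728000) : ℝ) : ℂ)
      + ((Real.sin x - (x - x^3/6 + x^5/120 - x^7/5040 + x^9/362880 - x^11/39916800
      + x^13/6227020800 - x^15/1307674368000 + x^17/355687428096000
      - x^19/121645100408832000) : ℝ) : ℂ) * Complex.I := by
    have e3 : Complex.I ^ 3 = - Complex.I := by rw [pow_succ, Complex.I_sq]; ring
    rw [Complex.exp_mul_I]
    simp only [Finset.sum_range_succ, Finset.sum_range_zero, mul_pow, Nat.factorial]
    rw [Complex.I_pow_eq_pow_mod 4, Complex.I_pow_eq_pow_mod 5, Complex.I_pow_eq_pow_mod 6,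
      Complex.I_pow_eq_pow_mod 7, Complex.I_pow_eq_pow_mod 8, Complex.I_pow_eq_pow_mod 9,
      Complex.I_pow_eq_pow_mod 10, Complex.I_pow_eq_pow_mod 11, Complex.I_pow_eq_pow_mod 12,
      Complex.I_pow_eq_pow_mod 13, Complex.I_pow_eq_pow_mod 14, Complex.I_pow_eq_pow_mod 15,
      Complex.I_pow_eq_pow_mod 16, Complex.I_pow_eq_pow_mod 17, Complex.I_pow_eq_pow_mod 18,
      Complex.I_pow_eq_pow_mod 19]
    norm_num only [Complex.I_sq, e3, pow_zero, pow_one]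
    push_cast
    ring
  rw [hs] at hb
  have hf : ((Nat.factorial 20 : ℕ) : ℝ) = 2432902008176640000 := by norm_num [Nat.factorial]
  rw [hf] at hb
  constructor
  · refine le_trans ?_ hb
    refine le_trans (le_of_eq ?_) (Complex.abs_re_le_norm _)
    rw [Complex.add_re, Complex.re_ofReal_mul, Complex.I_re, Complex.ofReal_re, mul_zero, add_zero]
  · refine le_trans ?_ hb
    refine le_trans (le_of_eq ?_) (Complex.abs_im_le_norm _)
    rw [Complex.add_im, Complex.im_ofReal_mul, Complex.I_im, Complex.ofReal_im, mul_one, zero_add]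

theorem near_trans {a p q d e : ℝ} (h : |a - p| ≤ d) (h2 : |p - q| ≤ e - d) : |a - q| ≤ e := by
  rw [abs_le] at *
  constructor <;> linarith [h.1, h.2, h2.1, h2.2]

theorem cos_num (x q : ℝ) (h0 : 0 ≤ x) (h1 : x ≤ 4)
    (h : |(1 - x^2/2 + x^4/24 - x^6/720 + x^8/40320 - x^10/3628800 + x^12/479001600
      - x^14/87178291200 + x^16/20922789888000 - x^18/6402373705728000) - q| ≤
      1/10^6 - x^20 / 2432902008176640000 * 2) : |Real.cos x - q| ≤ 1/10^6 :=
  near_trans (trig_bd x h0 h1).1 h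

theorem sin_num (x q : ℝ) (h0 : 0 ≤ x) (h1 : x ≤ 4)
    (h : |(x - x^3/6 + x^5/120 - x^7/5040 + x^9/362880 - x^11/39916800
      + x^13/6227020800 - x^15/1307674368000 + x^17/355687428096000
      - x^19/121645100408832000) - q| ≤
      1/10^6 - x^20 / 2432902008176640000 * 2) : |Real.sin x - q| ≤ 1/10^6 :=
  near_trans (trig_bd x h0 h1).2 h

theorem exp_num (x q : ℝ) (h0 : |x| ≤ 1)
    (h : |(∑ m ∈ Finset.range 12, x ^ m / (m.factorial : ℝ)) - q| ≤
      1/10^6 - |x| ^ 12 * (((12 : ℕ).succ : ℝ) / (((12 : ℕ).factorial : ℝ) * (12 : ℕ)))) :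
    |Real.exp x - q| ≤ 1/10^6 :=
  near_trans (Real.exp_bound h0 (by norm_num)) h

theorem mul_near {a b p q d e : ℝ} (ha : |a - p| ≤ d) (hb : |b - q| ≤ e) :
    |a * b - p * q| ≤ |p| * e + |q| * d + d * e := by
  have : a * b - p * q = p * (b - q) + q * (a - p) + (a - p) * (b - q) := by ring
  rw [this]
  have hd : 0 ≤ d := (abs_nonneg _).trans ha
  refine (abs_add_le _ _).trans (add_le_add ((abs_add_le _ _).trans (add_le_add ?_ ?_)) ?_)
  · rw [abs_mul]; gcongr
  · rw [abs_mul]; gcongr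
  · rw [abs_mul]; gcongr

theorem s34 : |Real.sin (17/5) - (-0.255541102)| ≤ 1/10^6 :=
  sin_num _ _ (by norm_num) (by norm_num) (by rw [abs_le]; norm_num)
theorem c34 : |Real.cos (17/5) - (-0.966798193)| ≤ 1/10^6 :=
  cos_num _ _ (by norm_num) (by norm_num) (by rw [abs_le]; norm_num)
theorem s35 : |Real.sin (139/40) - (-0.327264635)| ≤ 1/10^6 :=
  sin_num _ _ (by norm_num) (by norm_num) (by rw [abs_le]; norm_num)
theorem c35 : |Real.cos (139/40) - (-0.944932727)| ≤ 1/10^6 :=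
  cos_num _ _ (by norm_num) (by norm_num) (by rw [abs_le]; norm_num)
theorem s14 : |Real.sin (7/5) - 0.98544973| ≤ 1/10^6 :=
  sin_num _ _ (by norm_num) (by norm_num) (by rw [abs_le]; norm_num)
theorem c14 : |Real.cos (7/5) - 0.169967143| ≤ 1/10^6 :=
  cos_num _ _ (by norm_num) (by norm_num) (by rw [abs_le]; norm_num)
theorem s16 : |Real.sin (41/25) - 0.997606381| ≤ 1/10^6 :=
  sin_num _ _ (by norm_num) (by norm_num) (by rw [abs_le]; norm_num)
theorem c16 : |Real.cos (41/25) - (-0.069148449)| ≤ 1/10^6 :=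
  cos_num _ _ (by norm_num) (by norm_num) (by rw [abs_le]; norm_num)

theorem en34 : |Real.exp (-(17/5)/5) - 0.506616992| ≤ 1/10^6 :=
  exp_num _ _ (by rw [abs_le]; norm_num) (by
    rw [abs_of_neg (by norm_num : (-(17/5)/5 : ℝ) < 0), abs_le]
    norm_num [Finset.sum_range_succ, Nat.factorial])
theorem en35 : |Real.exp (-(139/40)/5) - 0.499074448| ≤ 1/10^6 :=
  exp_num _ _ (by rw [abs_le]; norm_num) (by
    rw [abs_of_neg (by norm_num : (-(139/40)/5 : ℝ) < 0), abs_le]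
    norm_num [Finset.sum_range_succ, Nat.factorial])
theorem ep34 : |Real.exp ((17/5)/5) - 1.973877732| ≤ 1/10^6 :=
  exp_num _ _ (by rw [abs_le]; norm_num) (by
    rw [abs_of_pos (by norm_num : (0 : ℝ) < (17/5)/5), abs_le]
    norm_num [Finset.sum_range_succ, Nat.factorial])
theorem ep35 : |Real.exp ((139/40)/5) - 2.003709074| ≤ 1/10^6 :=
  exp_num _ _ (by rw [abs_le]; norm_num) (by
    rw [abs_of_pos (by norm_num : (0 : ℝ) < (139/40)/5), abs_le]
    norm_num [Finset.sum_range_succ, Nat.factorial])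
theorem e14 : |Real.exp (-3*(7/5)/8) - 0.591555364| ≤ 1/10^6 :=
  exp_num _ _ (by rw [abs_le]; norm_num) (by
    rw [abs_of_neg (by norm_num : (-3*(7/5)/8 : ℝ) < 0), abs_le]
    norm_num [Finset.sum_range_succ, Nat.factorial])
theorem e16 : |Real.exp (-3*(41/25)/8) - 0.540640895| ≤ 1/10^6 :=
  exp_num _ _ (by rw [abs_le]; norm_num) (by
    rw [abs_of_neg (by norm_num : (-3*(41/25)/8 : ℝ) < 0), abs_le]
    norm_num [Finset.sum_range_succ, Nat.factorial])

/-- Abstract form of `e1`. -/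
theorem E1_near {su cu eu sv cv ev su' cu' eu' sv' cv' ev' d f : ℝ}
    (h1 : |su - su'| ≤ d) (h2 : |cu - cu'| ≤ d) (h3 : |eu - eu'| ≤ d)
    (h4 : |sv - sv'| ≤ f) (h5 : |cv - cv'| ≤ f) (h6 : |ev - ev'| ≤ f)
    (a1 : |su'| ≤ 1) (a2 : |cu'| ≤ 1) (a3 : |eu'| ≤ 1)
    (a4 : |sv'| ≤ 1) (a5 : |cv'| ≤ 1) (a6 : |ev'| ≤ 1) :
    |(1666 * su * cv + (245 * (cu - eu) - 385 * su) * sv - 1666 * su * ev)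
      - (1666 * su' * cv' + (245 * (cu' - eu') - 385 * su') * sv' - 1666 * su' * ev')|
      ≤ 4207 * (f + d + d * f) := by
  have hd : 0 ≤ d := (abs_nonneg _).trans h1
  have hf : 0 ≤ f := (abs_nonneg _).trans h4
  have key : ∀ a b p q : ℝ, |a - p| ≤ d → |b - q| ≤ f → |p| ≤ 1 → |q| ≤ 1 →
      |a * b - p * q| ≤ f + d + d * f := by
    intro a b p q ha hb hp hq
    have := mul_near ha hb
    nlinarith
  have k1 := abs_le.1 (key _ _ _ _ h1 h5 a1 a5)
  have k2 := abs_le.1 (key _ _ _ _ h2 h4 a2 a4)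
  have k3 := abs_le.1 (key _ _ _ _ h3 h4 a3 a4)
  have k4 := abs_le.1 (key _ _ _ _ h1 h4 a1 a4)
  have k5 := abs_le.1 (key _ _ _ _ h1 h6 a1 a6)
  rw [abs_le]
  constructor <;> linarith [k1.1, k1.2, k2.1, k2.2, k3.1, k3.2, k4.1, k4.2, k5.1, k5.2]

theorem mono_of {f f' : ℝ → ℝ} {a b : ℝ} (h : ∀ x, HasDerivAt f (f' x) x)
    (hp : ∀ x ∈ Set.Icc a b, 0 < f' x) : StrictMonoOn f (Set.Icc a b) := by
  apply strictMonoOn_of_deriv_pos (convex_Icc a b)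
  · exact fun x _ => (h x).continuousAt.continuousWithinAt
  · intro x hx
    rw [(h x).deriv]
    exact hp x (interior_subset hx)

theorem anti_of {f f' : ℝ → ℝ} {a b : ℝ} (h : ∀ x, HasDerivAt f (f' x) x)
    (hp : ∀ x ∈ Set.Icc a b, f' x < 0) : StrictAntiOn f (Set.Icc a b) := by
  apply strictAntiOn_of_deriv_neg (convex_Icc a b)
  · exact fun x _ => (h x).continuousAt.continuousWithinAt
  · intro x hx
    rw [(h x).deriv]
    exact hp x (interior_subset hx)

theorem e1_deriv (u v : ℝ) : HasDerivAt (fun v => e1 u v)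
    (1666 * Real.sin u * (-Real.sin v)
    + (245 * (Real.cos u - Real.exp (-u / 5)) - 385 * Real.sin u) * Real.cos v
    - 1666 * Real.sin u * (Real.exp (-3 * v / 8) * (-3 / 8))) v := by
  unfold e1
  have h : HasDerivAt (fun v : ℝ => -3 * v / 8) (-3/8) v := by
    simpa using ((hasDerivAt_id v).const_mul (-3)).div_const 8
  exact (((Real.hasDerivAt_cos v).const_mul _).add ((Real.hasDerivAt_sin v).const_mul _)).sub
    (h.exp.const_mul _)

theorem e2_deriv (v u : ℝ) : HasDerivAt (fun u => e2 u v)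
    ((-245 * (-Real.sin u - Real.exp (-u / 5) * (-1/5)) + 385 * Real.cos u) * Real.cos v
    + 1666 * Real.cos u * Real.sin v
    + (-385 * Real.cos u - 245 * (-Real.sin u) + 245 * (Real.exp (u / 5) * (1/5)))
      * Real.exp (-3 * v / 8)) u := by
  unfold e2
  have h : HasDerivAt (fun u : ℝ => -u / 5) (-1/5) u := by
    simpa using (hasDerivAt_id u).neg.div_const 5
  have h' : HasDerivAt (fun u : ℝ => u / 5) (1/5) u := by
    simpa using (hasDerivAt_id u).div_const 5
  have hs := Real.hasDerivAt_sin u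
  have hc := Real.hasDerivAt_cos u
  exact ((((hc.sub h.exp).const_mul _).add (hs.const_mul _)).mul_const _).add
    ((hs.const_mul _).mul_const _) |>.add
    ((((hs.const_mul _).sub (hc.const_mul _)).add (h'.exp.const_mul _)).mul_const _)

theorem v_bds {v : ℝ} (hv : v ∈ Set.Icc (7/5 : ℝ) (41/25)) :
    |Real.sin v - 0.98544973| ≤ 0.241 ∧ |Real.cos v - 0.169967143| ≤ 0.241 ∧
    0.54 ≤ Real.exp (-3 * v / 8) ∧ Real.exp (-3 * v / 8) ≤ 0.592 := by
  obtain ⟨h1, h2⟩ := hv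
  have hs := Real.abs_sin_sub_sin_le v (7/5)
  have hc := Real.abs_cos_sub_cos_le v (7/5)
  rw [abs_of_nonneg (by linarith : 0 ≤ v - 7/5)] at hs hc
  have m1 : Real.exp (-3 * v / 8) ≤ Real.exp (-3 * (7/5) / 8) := Real.exp_le_exp.2 (by linarith)
  have m2 : Real.exp (-3 * (41/25) / 8) ≤ Real.exp (-3 * v / 8) := Real.exp_le_exp.2 (by linarith)
  have := abs_le.1 s14; have := abs_le.1 c14; have := abs_le.1 e14; have := abs_le.1 e16
  rw [abs_le] at hs hc
  simp only [abs_le]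
  refine ⟨⟨?_, ?_⟩, ⟨?_, ?_⟩, ?_, ?_⟩ <;> linarith

theorem u_bds {u : ℝ} (hu : u ∈ Set.Icc (17/5 : ℝ) (139/40)) :
    |Real.sin u - (-0.255541102)| ≤ 0.076 ∧ |Real.cos u - (-0.966798193)| ≤ 0.076 ∧
    |Real.exp (-u / 5) - 0.506616992| ≤ 0.076 ∧ |Real.exp (u / 5) - 1.973877732| ≤ 0.076 := by
  obtain ⟨h1, h2⟩ := hu
  have hs := Real.abs_sin_sub_sin_le u (17/5)
  have hc := Real.abs_cos_sub_cos_le u (17/5)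
  rw [abs_of_nonneg (by linarith : 0 ≤ u - 17/5)] at hs hc
  have m1 : Real.exp (-u / 5) ≤ Real.exp (-(17/5) / 5) := Real.exp_le_exp.2 (by linarith)
  have m2 : Real.exp (-(139/40) / 5) ≤ Real.exp (-u / 5) := Real.exp_le_exp.2 (by linarith)
  have m3 : Real.exp ((17/5) / 5) ≤ Real.exp (u / 5) := Real.exp_le_exp.2 (by linarith)
  have m4 : Real.exp (u / 5) ≤ Real.exp ((139/40) / 5) := Real.exp_le_exp.2 (by linarith)
  have := abs_le.1 s34; have := abs_le.1 c34; have := abs_le.1 en34; have := abs_le.1 en35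
  have := abs_le.1 ep34; have := abs_le.1 ep35
  rw [abs_le] at hs hc
  simp only [abs_le]
  refine ⟨⟨?_, ?_⟩, ⟨?_, ?_⟩, ⟨?_, ?_⟩, ?_, ?_⟩ <;> linarith

theorem E2_near {su cu eu fu sv cv ev su' cu' eu' fu' sv' cv' ev' d f : ℝ}
    (h1 : |su - su'| ≤ d) (h2 : |cu - cu'| ≤ d) (h3 : |eu - eu'| ≤ d) (h7 : |fu - fu'| ≤ d)
    (h4 : |sv - sv'| ≤ f) (h5 : |cv - cv'| ≤ f) (h6 : |ev - ev'| ≤ f)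
    (a1 : |su'| ≤ 2.1) (a2 : |cu'| ≤ 2.1) (a3 : |eu'| ≤ 2.1) (a7 : |fu'| ≤ 2.1)
    (a4 : |sv'| ≤ 1) (a5 : |cv'| ≤ 1) (a6 : |ev'| ≤ 1) :
    |((-245 * (cu - eu) + 385 * su) * cv + 1666 * su * sv
        + (-385 * su - 245 * cu + 245 * fu) * ev)
      - ((-245 * (cu' - eu') + 385 * su') * cv' + 1666 * su' * sv'
        + (-385 * su' - 245 * cu' + 245 * fu') * ev')|
      ≤ 3416 * (2.1 * f + d + d * f) := by
  have hd : 0 ≤ d := (abs_nonneg _).trans h1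
  have hf : 0 ≤ f := (abs_nonneg _).trans h4
  have key : ∀ a b p q : ℝ, |a - p| ≤ d → |b - q| ≤ f → |p| ≤ 2.1 → |q| ≤ 1 →
      |a * b - p * q| ≤ 2.1 * f + d + d * f := by
    intro a b p q ha hb hp hq
    have := mul_near ha hb
    nlinarith
  have k1 := abs_le.1 (key _ _ _ _ h2 h5 a2 a5)
  have k2 := abs_le.1 (key _ _ _ _ h3 h5 a3 a5)
  have k3 := abs_le.1 (key _ _ _ _ h1 h5 a1 a5)
  have k4 := abs_le.1 (key _ _ _ _ h1 h4 a1 a4)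
  have k5 := abs_le.1 (key _ _ _ _ h1 h6 a1 a6)
  have k6 := abs_le.1 (key _ _ _ _ h2 h6 a2 a6)
  have k7 := abs_le.1 (key _ _ _ _ h7 h6 a7 a6)
  rw [abs_le]
  constructor <;> linarith [k1.1, k1.2, k2.1, k2.2, k3.1, k3.2, k4.1, k4.2, k5.1, k5.2,
    k6.1, k6.2, k7.1, k7.2]

theorem e1_a : e1 (17/5) (41/25) < 0 := by
  have := abs_le.1 (E1_near s34 c34 en34 s16 c16 e16 (by rw [abs_le]; norm_num)
    (by rw [abs_le]; norm_num) (by rw [abs_le]; norm_num) (by rw [abs_le]; norm_num)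
    (by rw [abs_le]; norm_num) (by rw [abs_le]; norm_num))
  unfold e1
  norm_num at this ⊢
  linarith [this.1, this.2]

theorem e1_b : 0 < e1 (139/40) (7/5) := by
  have := abs_le.1 (E1_near s35 c35 en35 s14 c14 e14 (by rw [abs_le]; norm_num)
    (by rw [abs_le]; norm_num) (by rw [abs_le]; norm_num) (by rw [abs_le]; norm_num)
    (by rw [abs_le]; norm_num) (by rw [abs_le]; norm_num))
  unfold e1
  norm_num at this ⊢
  linarith [this.1, this.2]

theorem e2_a : 0 < e2 (139/40) (7/5) := by
  have := abs_le.1 (E2_near s35 c35 en35 ep35 s14 c14 e14 (by rw [abs_le]; norm_num)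
    (by rw [abs_le]; norm_num) (by rw [abs_le]; norm_num) (by rw [abs_le]; norm_num)
    (by rw [abs_le]; norm_num) (by rw [abs_le]; norm_num) (by rw [abs_le]; norm_num))
  unfold e2
  norm_num at this ⊢
  linarith [this.1, this.2]

theorem e2_b : e2 (17/5) (41/25) < 0 := by
  have := abs_le.1 (E2_near s34 c34 en34 ep34 s16 c16 e16 (by rw [abs_le]; norm_num)
    (by rw [abs_le]; norm_num) (by rw [abs_le]; norm_num) (by rw [abs_le]; norm_num)
    (by rw [abs_le]; norm_num) (by rw [abs_le]; norm_num) (by rw [abs_le]; norm_num))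
  unfold e2
  norm_num at this ⊢
  linarith [this.1, this.2]

theorem d1 {su cu eu v : ℝ} (hv : v ∈ Set.Icc (7/5 : ℝ) (41/25))
    (h1 : su ≤ -0.2555) (h2 : -0.3273 ≤ su) (h3 : |245 * (cu - eu) - 385 * su| ≤ 264) :
    0 < 1666 * su * (-Real.sin v) + (245 * (cu - eu) - 385 * su) * Real.cos v
      - 1666 * su * (Real.exp (-3 * v / 8) * (-3 / 8)) := by
  obtain ⟨hs, hc, he1, he2⟩ := v_bds hv
  generalize Real.exp (-3 * v / 8) = E at *
  generalize 245 * (cu - eu) - 385 * su = B at *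
  have hc' : |Real.cos v| ≤ 0.42 := by
    rw [abs_le] at *; constructor <;> linarith [hc.1, hc.2]
  have hB : |B * Real.cos v| ≤ 264 * 0.42 := by
    rw [abs_mul]; gcongr
  have hB' := (abs_le.1 hB).1
  have hs' := (abs_le.1 hs).1
  have : 0.5 ≤ Real.sin v - 3/8 * E := by linarith
  nlinarith

/-- Sign conditions of the Poincaré–Miranda theorem on the box
`B₁ = [17/5, 139/40] × [7/5, 41/25]`. -/
theorem poincare_miranda_signs_B1 :
    (∀ v ∈ Set.Icc (7/5 : ℝ) (41/25), e1 (17/5) v < 0 ∧ 0 < e1 (139/40) v) ∧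
    (∀ u ∈ Set.Icc (17/5 : ℝ) (139/40), 0 < e2 u (7/5) ∧ e2 u (41/25) < 0) := by
  have S34 := abs_le.1 s34
  have C34 := abs_le.1 c34
  have N34 := abs_le.1 en34
  have S35 := abs_le.1 s35
  have C35 := abs_le.1 c35
  have N35 := abs_le.1 en35
  have m1 := mono_of (e1_deriv (17/5)) (a := 7/5) (b := 41/25) (fun v hv => d1 hv
    (by linarith) (by linarith) (by rw [abs_le]; constructor <;> linarith))
  have m2 := mono_of (e1_deriv (139/40)) (a := 7/5) (b := 41/25) (fun v hv => d1 hv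
    (by linarith) (by linarith) (by rw [abs_le]; constructor <;> linarith))
  have D : ∀ v u, (v = 7/5 ∨ v = 41/25) → u ∈ Set.Icc (17/5 : ℝ) (139/40) →
    ((-245 * (-Real.sin u - Real.exp (-u / 5) * (-1/5)) + 385 * Real.cos u) * Real.cos v
    + 1666 * Real.cos u * Real.sin v
    + (-385 * Real.cos u - 245 * (-Real.sin u) + 245 * (Real.exp (u / 5) * (1/5)))
      * Real.exp (-3 * v / 8)) < 0 := by
    intro v u hv hu
    obtain ⟨h1, h2, h3, h4⟩ := u_bds hu
    have g : 0.98 ≤ Real.sin v ∧ |Real.cos v| ≤ 0.17 ∧ |Real.exp (-3 * v / 8)| ≤ 0.6 := by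
      have := abs_le.1 s14; have := abs_le.1 c14; have := abs_le.1 e14; have := abs_le.1 e16
      have := abs_le.1 s16; have := abs_le.1 c16
      rcases hv with rfl | rfl <;> simp only [abs_le] <;>
      refine ⟨?_, ⟨?_, ?_⟩, ?_, ?_⟩ <;> linarith
    obtain ⟨g1, g2, g3⟩ := g
    generalize Real.exp (-3 * v / 8) = E at *
    rw [abs_le] at h1 h2 h3 h4
    have i1 : |(-245 * (-Real.sin u - Real.exp (-u / 5) * (-1/5)) + 385 * Real.cos u)| ≤ 520 := by
      rw [abs_le]; constructor <;> linarith
    have i2 : |(-385 * Real.cos u - 245 * (-Real.sin u) + 245 * (Real.exp (u / 5) * (1/5)))|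
        ≤ 520 := by
      rw [abs_le]; constructor <;> linarith
    have j1 := (abs_le.1 ((abs_mul _ _).le.trans
      (mul_le_mul i1 g2 (abs_nonneg _) (by norm_num)))).2
    have j2 := (abs_le.1 ((abs_mul _ _).le.trans
      (mul_le_mul i2 g3 (abs_nonneg _) (by norm_num)))).2
    have j3 : Real.cos u * Real.sin v ≤ -0.85 := by nlinarith
    linarith
  have m3 := anti_of (e2_deriv (7/5)) (a := 17/5) (b := 139/40)
    (fun u hu => D _ u (Or.inl rfl) hu)
  have m4 := anti_of (e2_deriv (41/25)) (a := 17/5) (b := 139/40)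
    (fun u hu => D _ u (Or.inr rfl) hu)
  refine ⟨fun v hv => ⟨?_, ?_⟩, fun u hu => ⟨?_, ?_⟩⟩
  · exact (m1.monotoneOn hv (Set.right_mem_Icc.2 (by norm_num)) hv.2).trans_lt e1_a
  · exact e1_b.trans_le (m2.monotoneOn (Set.left_mem_Icc.2 (by norm_num)) hv hv.1)
  · exact e2_a.trans_le (m3.antitoneOn hu (Set.right_mem_Icc.2 (by norm_num)) hu.2)
  · exact (m4.antitoneOn (Set.left_mem_Icc.2 (by norm_num)) hu hu.1).trans_lt e2_b
end

section
/- Define e₁(u,v) = 1666 sin(u) cos(v) + (245(cos(u) − e^{−u/5}) − 385 sin(u)) sin(v) − 1666 sin(u) e^{−3v/8} and e₂(u,v) = (−245(cos(u) − e^{−u/5}) + 385 sin(u)) cos(v) + 1666 sin(u) sin(v) + (−385 sin(u) − 245 cos(u) + 245 e^{u/5}) e^{−3v/8}. Then on the rectangle B₃ = [219/50, 239/50] × [9/25, 47/100] the following sign conditions hold: e₁(219/50, v) < 0 and e₁(239/50, v) > 0 for all v ∈ [9/25, 47/100], and e₂(u, 9/25) > 0 and e₂(u, 47/100) < 0 for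 all u ∈ [219/50, 239/50]. -/
open Real

lemma aux_mono (f f' : ℝ → ℝ) (h0 : 0 ≤ f 0) (hf : ∀ x, HasDerivAt f (f' x) x)
    (hp : ∀ x, 0 ≤ x → 0 ≤ f' x) (x : ℝ) (hx : 0 ≤ x) : 0 ≤ f x := by
  have hm : MonotoneOn f (Set.Ici 0) := by
    apply monotoneOn_of_deriv_nonneg (convex_Ici 0)
    · exact fun y _ => (hf y).continuousAt.continuousWithinAt
    · exact fun y _ => (hf y).differentiableAt.differentiableWithinAt
    · intro y hy
      rw [interior_Ici] at hy
      rw [(hf y).deriv]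
      exact hp y (le_of_lt hy)
  exact h0.trans (hm (Set.mem_Ici.2 le_rfl) (Set.mem_Ici.2 hx) hx)

lemma dpow (n : ℕ) (c x : ℝ) : HasDerivAt (fun y : ℝ => y ^ n / c) (n * x ^ (n - 1) / c) x :=
  (hasDerivAt_pow n x).div_const c

lemma cos_up4 (x : ℝ) (hx : 0 ≤ x) : cos x ≤ 1 - x ^ 2 / 2 + x ^ 4 / 24 := by
  have := aux_mono (fun x => 1 - x ^ 2 / 2 + x ^ 4 / 24 - cos x) (fun x => sin x - (x - x ^ 3 / 6))
    (by norm_num)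
    (fun x => by
      refine HasDerivAt.congr_deriv ((((dpow 2 2 x).const_sub 1).add (dpow 4 24 x)).sub
        (hasDerivAt_cos x)) ?_
      norm_num
      ring)
    (fun x hx => sub_nonneg.2 (sin_ge_sub_cube hx)) x hx
  linarith

lemma sin_up5 (x : ℝ) (hx : 0 ≤ x) : sin x ≤ x - x ^ 3 / 6 + x ^ 5 / 120 := by
  have := aux_mono (fun x => x - x ^ 3 / 6 + x ^ 5 / 120 - sin x)
    (fun x => 1 - x ^ 2 / 2 + x ^ 4 / 24 - cos x)
    (by norm_num)
    (fun x => by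
      refine HasDerivAt.congr_deriv ((((hasDerivAt_id x).sub (dpow 3 6 x)).add (dpow 5 120 x)).sub
        (hasDerivAt_sin x)) ?_
      norm_num
      ring)
    (fun x hx => sub_nonneg.2 (cos_up4 x hx)) x hx
  linarith

lemma cos_lo6 (x : ℝ) (hx : 0 ≤ x) : 1 - x ^ 2 / 2 + x ^ 4 / 24 - x ^ 6 / 720 ≤ cos x := by
  have := aux_mono (fun x => cos x - (1 - x ^ 2 / 2 + x ^ 4 / 24 - x ^ 6 / 720))
    (fun x => x - x ^ 3 / 6 + x ^ 5 / 120 - sin x)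
    (by norm_num)
    (fun x => by
      refine HasDerivAt.congr_deriv ((hasDerivAt_cos x).sub
        ((((dpow 2 2 x).const_sub 1).add (dpow 4 24 x)).sub (dpow 6 720 x))) ?_
      norm_num
      ring)
    (fun x hx => sub_nonneg.2 (sin_up5 x hx)) x hx
  linarith

lemma sin_lo7 (x : ℝ) (hx : 0 ≤ x) : x - x ^ 3 / 6 + x ^ 5 / 120 - x ^ 7 / 5040 ≤ sin x := by
  have := aux_mono (fun x => sin x - (x - x ^ 3 / 6 + x ^ 5 / 120 - x ^ 7 / 5040))
    (fun x => cos x - (1 - x ^ 2 / 2 + x ^ 4 / 24 - x ^ 6 / 720))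
    (by norm_num)
    (fun x => by
      refine HasDerivAt.congr_deriv ((hasDerivAt_sin x).sub
        ((((hasDerivAt_id x).sub (dpow 3 6 x)).add (dpow 5 120 x)).sub (dpow 7 5040 x))) ?_
      norm_num
      ring)
    (fun x hx => sub_nonneg.2 (cos_lo6 x hx)) x hx
  linarith

lemma cos_up8 (x : ℝ) (hx : 0 ≤ x) :
    cos x ≤ 1 - x ^ 2 / 2 + x ^ 4 / 24 - x ^ 6 / 720 + x ^ 8 / 40320 := by
  have := aux_mono (fun x => 1 - x ^ 2 / 2 + x ^ 4 / 24 - x ^ 6 / 720 + x ^ 8 / 40320 - cos x)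
    (fun x => sin x - (x - x ^ 3 / 6 + x ^ 5 / 120 - x ^ 7 / 5040))
    (by norm_num)
    (fun x => by
      refine HasDerivAt.congr_deriv (((((dpow 2 2 x).const_sub 1).add (dpow 4 24 x)).sub
        (dpow 6 720 x)).add (dpow 8 40320 x) |>.sub (hasDerivAt_cos x)) ?_
      norm_num
      ring)
    (fun x hx => sub_nonneg.2 (sin_lo7 x hx)) x hx
  linarith

lemma cos_near (x a d : ℝ) (hx : 0 ≤ x)
    (h1 : a - d ≤ 1 - x ^ 2 / 2 + x ^ 4 / 24 - x ^ 6 / 720)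
    (h2 : 1 - x ^ 2 / 2 + x ^ 4 / 24 - x ^ 6 / 720 + x ^ 8 / 40320 ≤ a + d) : |cos x - a| ≤ d := by
  rw [abs_le]
  constructor <;> linarith [cos_lo6 x hx, cos_up8 x hx]

lemma sin_near (x a d : ℝ) (hx : 0 ≤ x)
    (h1 : a - d ≤ x - x ^ 3 / 6 + x ^ 5 / 120 - x ^ 7 / 5040)
    (h2 : x - x ^ 3 / 6 + x ^ 5 / 120 ≤ a + d) : |sin x - a| ≤ d := by
  rw [abs_le]
  constructor <;> linarith [sin_lo7 x hx, sin_up5 x hx]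

lemma exp_quad (x : ℝ) (hx : |x| ≤ 1) : |exp x - (1 + x + x ^ 2 / 2)| ≤ |x| ^ 3 * (2 / 9) := by
  have := Real.exp_bound hx (n := 3) (by norm_num)
  norm_num [Finset.sum_range_succ, Nat.factorial] at this
  exact this

lemma mulb {a b a0 b0 : ℝ} (ha : |a - a0| ≤ 2 / 10 ^ 6) (hb : |b - b0| ≤ 2 / 10 ^ 6)
    (h1 : |a0| ≤ 3) (h2 : |b0| ≤ 1) : |a * b - a0 * b0| ≤ 1 / 10 ^ 5 := by
  have e : a * b - a0 * b0 = (a - a0) * (b - b0) + a0 * (b - b0) + (a - a0) * b0 := by ring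
  rw [e]
  have t1 := abs_add_three ((a - a0) * (b - b0)) (a0 * (b - b0)) ((a - a0) * b0)
  simp only [abs_mul] at t1
  have := mul_le_mul ha hb (abs_nonneg _) (by norm_num)
  have := mul_le_mul h1 hb (abs_nonneg _) (by norm_num)
  have := mul_le_mul ha h2 (abs_nonneg _) (by norm_num)
  linarith

lemma wpow (w M : ℝ) (hw : 0 ≤ w) (hM : w ≤ M) :
    w^2 ≤ M * w ∧ w^3 ≤ M * w^2 ∧ w^4 ≤ M * w^3 ∧ w^5 ≤ M * w^4 := by
  refine ⟨?_, ?_, ?_, ?_⟩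
  · nlinarith [mul_le_mul_of_nonneg_right hM hw]
  · nlinarith [mul_le_mul_of_nonneg_right hM (pow_nonneg hw 2)]
  · nlinarith [mul_le_mul_of_nonneg_right hM (pow_nonneg hw 3)]
  · nlinarith [mul_le_mul_of_nonneg_right hM (pow_nonneg hw 4)]

lemma pi_near : |π - 314159265/10^8| ≤ 1/10^8 := by
  have := pi_gt_d20
  have := pi_lt_d20
  rw [abs_le]
  constructor <;> linarith


lemma sin_a : |sin (9/25) - (35227423/10^8)| ≤ 2/10^6 := by
  apply sin_near <;> norm_num

lemma cos_a : |cos (9/25) - (93589682/10^8)| ≤ 2/10^6 := by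
  apply cos_near <;> norm_num


lemma sin_b : |sin (47/100) - (45288629/10^8)| ≤ 2/10^6 := by
  apply sin_near <;> norm_num

lemma cos_b : |cos (47/100) - (89156829/10^8)| ≤ 2/10^6 := by
  apply cos_near <;> norm_num


lemma exp_m876 : |exp (-(219/250)) - (41644537/10^8)| ≤ 2/10^6 := by
  have h := Real.exp_bound (x := -(219/250)) (by rw [abs_le]; constructor <;> norm_num) (n := 12) (by norm_num)
  rw [abs_le] at h ⊢
  norm_num [Finset.sum_range_succ, Nat.factorial, abs_of_pos, abs_of_neg] at h ⊢
  constructor <;> linarith [h.1, h.2]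


lemma exp_p876 : |exp (219/250) - (240127537/10^8)| ≤ 2/10^6 := by
  have h := Real.exp_bound (x := 219/250) (by rw [abs_le]; constructor <;> norm_num) (n := 12) (by norm_num)
  rw [abs_le] at h ⊢
  norm_num [Finset.sum_range_succ, Nat.factorial, abs_of_pos, abs_of_neg] at h ⊢
  constructor <;> linarith [h.1, h.2]


lemma exp_m956 : |exp (-(239/250)) - (38442752/10^8)| ≤ 2/10^6 := by
  have h := Real.exp_bound (x := -(239/250)) (by rw [abs_le]; constructor <;> norm_num) (n := 12) (by norm_num)
  rw [abs_le] at h ⊢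
  norm_num [Finset.sum_range_succ, Nat.factorial, abs_of_pos, abs_of_neg] at h ⊢
  constructor <;> linarith [h.1, h.2]


lemma exp_p956 : |exp (239/250) - (260127055/10^8)| ≤ 2/10^6 := by
  have h := Real.exp_bound (x := 239/250) (by rw [abs_le]; constructor <;> norm_num) (n := 12) (by norm_num)
  rw [abs_le] at h ⊢
  norm_num [Finset.sum_range_succ, Nat.factorial, abs_of_pos, abs_of_neg] at h ⊢
  constructor <;> linarith [h.1, h.2]


lemma exp_a : |exp (-(27/200)) - (87371591/10^8)| ≤ 2/10^6 := by
  have h := Real.exp_bound (x := -(27/200)) (by rw [abs_le]; constructor <;> norm_num) (n := 12) (by norm_num)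
  rw [abs_le] at h ⊢
  norm_num [Finset.sum_range_succ, Nat.factorial, abs_of_pos, abs_of_neg] at h ⊢
  constructor <;> linarith [h.1, h.2]


lemma exp_b : |exp (-(141/800)) - (83840836/10^8)| ≤ 2/10^6 := by
  have h := Real.exp_bound (x := -(141/800)) (by rw [abs_le]; constructor <;> norm_num) (n := 12) (by norm_num)
  rw [abs_le] at h ⊢
  norm_num [Finset.sum_range_succ, Nat.factorial, abs_of_pos, abs_of_neg] at h ⊢
  constructor <;> linarith [h.1, h.2]


lemma S1 : |sin (219/50) - (-94526551/10^8)| ≤ 2/10^6 := by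
  have e : sin (219/50) = - cos (3 * (π/2) - 219/50) := by
    rw [show (219/50 : ℝ) = π + (π / 2 - (3 * (π/2) - 219/50)) by ring, add_comm π, sin_add_pi,
      sin_pi_div_two_sub]
    congr 2
    ring
  rw [e]
  have h := abs_cos_sub_cos_le (3 * (π/2) - 219/50) (33238898/10^8)
  have h2 := cos_near (33238898/10^8) (94526551/10^8) (1/10^6) (by norm_num) (by norm_num) (by norm_num)
  have h3 : |3 * (π/2) - 219/50 - (33238898/10^8)| ≤ 5/10^8 := by
    have := abs_le.1 pi_near
    rw [abs_le]
    constructor <;> linarith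
  have h := abs_le.1 (h.trans h3)
  have h2 := abs_le.1 h2
  rw [abs_le]
  constructor <;> linarith

lemma C1 : |cos (219/50) - (-32630218/10^8)| ≤ 2/10^6 := by
  have e : cos (219/50) = - sin (3 * (π/2) - 219/50) := by
    rw [show (219/50 : ℝ) = π + (π / 2 - (3 * (π/2) - 219/50)) by ring, add_comm π, cos_add_pi,
      cos_pi_div_two_sub]
    congr 2
    ring
  rw [e]
  have h := abs_sin_sub_sin_le (3 * (π/2) - 219/50) (33238898/10^8)
  have h2 := sin_near (33238898/10^8) (32630218/10^8) (1/10^6) (by norm_num) (by norm_num) (by norm_num)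
  have h3 : |3 * (π/2) - 219/50 - (33238898/10^8)| ≤ 5/10^8 := by
    have := abs_le.1 pi_near
    rw [abs_le]
    constructor <;> linarith
  have h := abs_le.1 (h.trans h3)
  have h2 := abs_le.1 h2
  rw [abs_le]
  constructor <;> linarith


lemma S2 : |sin (239/50) - (-99771525/10^8)| ≤ 2/10^6 := by
  have e : sin (239/50) = - cos (239/50 - 3 * (π/2)) := by
    rw [show (239/50 : ℝ) = π + (π / 2 + (239/50 - 3 * (π/2))) by ring, add_comm π, sin_add_pi,
      add_comm (π/2), sin_add_pi_div_two]
    congr 2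
    ring
  rw [e]
  have h := abs_cos_sub_cos_le (239/50 - 3 * (π/2)) (6761102/10^8)
  have h2 := cos_near (6761102/10^8) (99771525/10^8) (1/10^6) (by norm_num) (by norm_num) (by norm_num)
  have h3 : |239/50 - 3 * (π/2) - (6761102/10^8)| ≤ 5/10^8 := by
    have := abs_le.1 pi_near
    rw [abs_le]
    constructor <;> linarith
  have h := abs_le.1 (h.trans h3)
  have h2 := abs_le.1 h2
  rw [abs_le]
  constructor <;> linarith

lemma C2 : |cos (239/50) - (6755952/10^8)| ≤ 2/10^6 := by
  have e : cos (239/50) = sin (239/50 - 3 * (π/2)) := by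
    rw [show (239/50 : ℝ) = π + (π / 2 + (239/50 - 3 * (π/2))) by ring, add_comm π, cos_add_pi,
      add_comm (π/2), cos_add_pi_div_two, neg_neg]
    congr 1
    ring
  rw [e]
  have h := abs_sin_sub_sin_le (239/50 - 3 * (π/2)) (6761102/10^8)
  have h2 := sin_near (6761102/10^8) (6755952/10^8) (1/10^6) (by norm_num) (by norm_num) (by norm_num)
  have h3 : |239/50 - 3 * (π/2) - (6761102/10^8)| ≤ 5/10^8 := by
    have := abs_le.1 pi_near
    rw [abs_le]
    constructor <;> linarith
  have h := abs_le.1 (h.trans h3)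
  have h2 := abs_le.1 h2
  rw [abs_le]
  constructor <;> linarith

lemma p1 (S C E F s c X w : ℝ) (hw : 0 ≤ w) (hw2 : w ≤ 11/100)
    (hS : |S - (-94526551/10^8)| ≤ 2/10^6) (hC : |C - (-32630218/10^8)| ≤ 2/10^6)
    (hE : |E - (41644537/10^8)| ≤ 2/10^6) (hF : |F - (240127537/10^8)| ≤ 2/10^6)
    (hs : |s - (45288629/10^8)| ≤ 2/10^6) (hc : |c - (89156829/10^8)| ≤ 2/10^6)
    (hX : |X - (83840836/10^8)| ≤ 2/10^6) :
    (1666*S*c+(245*(C-E)-385*S)*s)*cos w + (-1*(-1666*S*s+(245*(C-E)-385*S)*c))*sin w + (-1666*S*X)*exp (3*w/8) < 0 := by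
  have hSs := abs_le.1 (mulb hS hs (by norm_num [abs_le]) (by norm_num [abs_le]))
  have hSc := abs_le.1 (mulb hS hc (by norm_num [abs_le]) (by norm_num [abs_le]))
  have hSX := abs_le.1 (mulb hS hX (by norm_num [abs_le]) (by norm_num [abs_le]))
  have hCs := abs_le.1 (mulb hC hs (by norm_num [abs_le]) (by norm_num [abs_le]))
  have hCc := abs_le.1 (mulb hC hc (by norm_num [abs_le]) (by norm_num [abs_le]))
  have hCX := abs_le.1 (mulb hC hX (by norm_num [abs_le]) (by norm_num [abs_le]))
  have hEs := abs_le.1 (mulb hE hs (by norm_num [abs_le]) (by norm_num [abs_le]))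
  have hEc := abs_le.1 (mulb hE hc (by norm_num [abs_le]) (by norm_num [abs_le]))
  have hEX := abs_le.1 (mulb hE hX (by norm_num [abs_le]) (by norm_num [abs_le]))
  have hFs := abs_le.1 (mulb hF hs (by norm_num [abs_le]) (by norm_num [abs_le]))
  have hFc := abs_le.1 (mulb hF hc (by norm_num [abs_le]) (by norm_num [abs_le]))
  have hFX := abs_le.1 (mulb hF hX (by norm_num [abs_le]) (by norm_num [abs_le]))
  clear hS hC hE hF hs hc hX
  have cw1 : 1 - w^2/2 ≤ cos w := one_sub_sq_div_two_le_cos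
  have cw2 := cos_up4 w hw
  have sw1 := sin_ge_sub_cube hw
  have sw2 := sin_up5 w hw
  have K0 : 1666*S*c+(245*(C-E)-385*S)*s ≤ -132159/100 := by linarith only [hSs.1, hSs.2, hSc.1, hSc.2, hSX.1, hSX.2, hCs.1, hCs.2, hCc.1, hCc.2, hCX.1, hCX.2, hEs.1, hEs.2, hEc.1, hEc.2, hFX.1, hFX.2]
  have L0 := mul_le_mul_of_nonneg_right K0 ((cos_nonneg_of_neg_pi_div_two_le_of_le (by linarith only [hw, hw2, pi_gt_three]) (by linarith only [hw, hw2, pi_gt_three])) : 0 ≤ cos w)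
  have K1 : -1*(-1666*S*s+(245*(C-E)-385*S)*c) ≤ -43769/50 := by linarith only [hSs.1, hSs.2, hSc.1, hSc.2, hSX.1, hSX.2, hCs.1, hCs.2, hCc.1, hCc.2, hCX.1, hCX.2, hEs.1, hEs.2, hEc.1, hEc.2, hFX.1, hFX.2]
  have L1 := mul_le_mul_of_nonneg_right K1 ((sin_nonneg_of_nonneg_of_le_pi hw (by linarith only [hw, hw2, pi_gt_three])) : 0 ≤ sin w)
  have ee2 := abs_le.1 (exp_quad (3*w/8) (by rw [abs_le]; constructor <;> linarith only [hw, hw2]))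
  have eb2 : |(3*w/8)| ^ 3 = w ^ 3 * (27/512) := by
    rw [show (3*w/8) = w * (3*1/8) by ring, abs_mul, mul_pow, abs_of_nonneg hw]
    norm_num [abs_of_pos, abs_of_neg]
  rw [eb2] at ee2
  have pp2 := exp_pos (3*w/8)
  have K2 : -1666*S*X ≤ 6602/5 := by linarith only [hSs.1, hSs.2, hSc.1, hSc.2, hSX.1, hSX.2, hCs.1, hCs.2, hCc.1, hCc.2, hCX.1, hCX.2, hEs.1, hEs.2, hEc.1, hEc.2, hFX.1, hFX.2]
  have L2 := mul_le_mul_of_nonneg_right K2 (pp2.le : 0 ≤ exp (3*w/8))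
  clear hSs hSc hSX hCs hCc hCX hEs hEc hEX hFs hFc hFX
  obtain ⟨w2, w3, w4, w5⟩ := wpow w (11/100) hw hw2
  linarith [pow_nonneg hw 2, pow_nonneg hw 3, pow_nonneg hw 4, pow_nonneg hw 5, ee2.1, ee2.2, ee2.1, ee2.2]

lemma p2 (S C E F s c X w : ℝ) (hw : 0 ≤ w) (hw2 : w ≤ 11/100)
    (hS : |S - (-99771525/10^8)| ≤ 2/10^6) (hC : |C - (6755952/10^8)| ≤ 2/10^6)
    (hE : |E - (38442752/10^8)| ≤ 2/10^6) (hF : |F - (260127055/10^8)| ≤ 2/10^6)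
    (hs : |s - (35227423/10^8)| ≤ 2/10^6) (hc : |c - (93589682/10^8)| ≤ 2/10^6)
    (hX : |X - (87371591/10^8)| ≤ 2/10^6) :
    0 < (1666*S*c+(245*(C-E)-385*S)*s)*cos w + (1*(-1666*S*s+(245*(C-E)-385*S)*c))*sin w + (-1666*S*X)*exp (-3*w/8) := by
  have hSs := abs_le.1 (mulb hS hs (by norm_num [abs_le]) (by norm_num [abs_le]))
  have hSc := abs_le.1 (mulb hS hc (by norm_num [abs_le]) (by norm_num [abs_le]))
  have hSX := abs_le.1 (mulb hS hX (by norm_num [abs_le]) (by norm_num [abs_le]))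
  have hCs := abs_le.1 (mulb hC hs (by norm_num [abs_le]) (by norm_num [abs_le]))
  have hCc := abs_le.1 (mulb hC hc (by norm_num [abs_le]) (by norm_num [abs_le]))
  have hCX := abs_le.1 (mulb hC hX (by norm_num [abs_le]) (by norm_num [abs_le]))
  have hEs := abs_le.1 (mulb hE hs (by norm_num [abs_le]) (by norm_num [abs_le]))
  have hEc := abs_le.1 (mulb hE hc (by norm_num [abs_le]) (by norm_num [abs_le]))
  have hEX := abs_le.1 (mulb hE hX (by norm_num [abs_le]) (by norm_num [abs_le]))
  have hFs := abs_le.1 (mulb hF hs (by norm_num [abs_le]) (by norm_num [abs_le]))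
  have hFc := abs_le.1 (mulb hF hc (by norm_num [abs_le]) (by norm_num [abs_le]))
  have hFX := abs_le.1 (mulb hF hX (by norm_num [abs_le]) (by norm_num [abs_le]))
  clear hS hC hE hF hs hc hX
  have cw1 : 1 - w^2/2 ≤ cos w := one_sub_sq_div_two_le_cos
  have cw2 := cos_up4 w hw
  have sw1 := sin_ge_sub_cube hw
  have sw2 := sin_up5 w hw
  have K0 : -144773/100 ≤ 1666*S*c+(245*(C-E)-385*S)*s := by linarith only [hSs.1, hSs.2, hSc.1, hSc.2, hSX.1, hSX.2, hCs.1, hCs.2, hCc.1, hCc.2, hCX.1, hCX.2, hEs.1, hEs.2, hEc.1, hEc.2, hFX.1, hFX.2]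
  have L0 := mul_le_mul_of_nonneg_right K0 ((cos_nonneg_of_neg_pi_div_two_le_of_le (by linarith only [hw, hw2, pi_gt_three]) (by linarith only [hw, hw2, pi_gt_three])) : 0 ≤ cos w)
  have K1 : 87233/100 ≤ 1*(-1666*S*s+(245*(C-E)-385*S)*c) := by linarith only [hSs.1, hSs.2, hSc.1, hSc.2, hSX.1, hSX.2, hCs.1, hCs.2, hCc.1, hCc.2, hCX.1, hCX.2, hEs.1, hEs.2, hEc.1, hEc.2, hFX.1, hFX.2]
  have L1 := mul_le_mul_of_nonneg_right K1 ((sin_nonneg_of_nonneg_of_le_pi hw (by linarith only [hw, hw2, pi_gt_three])) : 0 ≤ sin w)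
  have ee2 := abs_le.1 (exp_quad (-3*w/8) (by rw [abs_le]; constructor <;> linarith only [hw, hw2]))
  have eb2 : |(-3*w/8)| ^ 3 = w ^ 3 * (27/512) := by
    rw [show (-3*w/8) = w * (-3*1/8) by ring, abs_mul, mul_pow, abs_of_nonneg hw]
    norm_num [abs_of_pos, abs_of_neg]
  rw [eb2] at ee2
  have pp2 := exp_pos (-3*w/8)
  have K2 : 72611/50 ≤ -1666*S*X := by linarith only [hSs.1, hSs.2, hSc.1, hSc.2, hSX.1, hSX.2, hCs.1, hCs.2, hCc.1, hCc.2, hCX.1, hCX.2, hEs.1, hEs.2, hEc.1, hEc.2, hFX.1, hFX.2]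
  have L2 := mul_le_mul_of_nonneg_right K2 (pp2.le : 0 ≤ exp (-3*w/8))
  clear hSs hSc hSX hCs hCc hCX hEs hEc hEX hFs hFc hFX
  obtain ⟨w2, w3, w4, w5⟩ := wpow w (11/100) hw hw2
  linarith [pow_nonneg hw 2, pow_nonneg hw 3, pow_nonneg hw 4, pow_nonneg hw 5, ee2.1, ee2.2, ee2.1, ee2.2]

lemma p3 (S C E F s c X w : ℝ) (hw : 0 ≤ w) (hw2 : w ≤ 2/5)
    (hS : |S - (-99771525/10^8)| ≤ 2/10^6) (hC : |C - (6755952/10^8)| ≤ 2/10^6)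
    (hE : |E - (38442752/10^8)| ≤ 2/10^6) (hF : |F - (260127055/10^8)| ≤ 2/10^6)
    (hs : |s - (35227423/10^8)| ≤ 2/10^6) (hc : |c - (93589682/10^8)| ≤ 2/10^6)
    (hX : |X - (87371591/10^8)| ≤ 2/10^6) :
    0 < ((385*c+1666*s-385*X)*S+(-245*c-245*X)*C)*cos w + (-1*((385*c+1666*s-385*X)*C-(-245*c-245*X)*S))*sin w + (245*c*E)*exp (1*w/5) + (245*X*F)*exp (-1*w/5) := by
  have hSs := abs_le.1 (mulb hS hs (by norm_num [abs_le]) (by norm_num [abs_le]))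
  have hSc := abs_le.1 (mulb hS hc (by norm_num [abs_le]) (by norm_num [abs_le]))
  have hSX := abs_le.1 (mulb hS hX (by norm_num [abs_le]) (by norm_num [abs_le]))
  have hCs := abs_le.1 (mulb hC hs (by norm_num [abs_le]) (by norm_num [abs_le]))
  have hCc := abs_le.1 (mulb hC hc (by norm_num [abs_le]) (by norm_num [abs_le]))
  have hCX := abs_le.1 (mulb hC hX (by norm_num [abs_le]) (by norm_num [abs_le]))
  have hEs := abs_le.1 (mulb hE hs (by norm_num [abs_le]) (by norm_num [abs_le]))
  have hEc := abs_le.1 (mulb hE hc (by norm_num [abs_le]) (by norm_num [abs_le]))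
  have hEX := abs_le.1 (mulb hE hX (by norm_num [abs_le]) (by norm_num [abs_le]))
  have hFs := abs_le.1 (mulb hF hs (by norm_num [abs_le]) (by norm_num [abs_le]))
  have hFc := abs_le.1 (mulb hF hc (by norm_num [abs_le]) (by norm_num [abs_le]))
  have hFX := abs_le.1 (mulb hF hX (by norm_num [abs_le]) (by norm_num [abs_le]))
  clear hS hC hE hF hs hc hX
  have cw1 : 1 - w^2/2 ≤ cos w := one_sub_sq_div_two_le_cos
  have cw2 := cos_up4 w hw
  have sw1 := sin_ge_sub_cube hw
  have sw2 := sin_up5 w hw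
  have K0 : -12789/20 ≤ (385*c+1666*s-385*X)*S+(-245*c-245*X)*C := by linarith only [hSs.1, hSs.2, hSc.1, hSc.2, hSX.1, hSX.2, hCs.1, hCs.2, hCc.1, hCc.2, hCX.1, hCX.2, hEs.1, hEs.2, hEc.1, hEc.2, hFX.1, hFX.2]
  have L0 := mul_le_mul_of_nonneg_right K0 ((cos_nonneg_of_neg_pi_div_two_le_of_le (by linarith only [hw, hw2, pi_gt_three]) (by linarith only [hw, hw2, pi_gt_three])) : 0 ≤ cos w)
  have K1 : 40101/100 ≤ -1*((385*c+1666*s-385*X)*C-(-245*c-245*X)*S) := by linarith only [hSs.1, hSs.2, hSc.1, hSc.2, hSX.1, hSX.2, hCs.1, hCs.2, hCc.1, hCc.2, hCX.1, hCX.2, hEs.1, hEs.2, hEc.1, hEc.2, hFX.1, hFX.2]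
  have L1 := mul_le_mul_of_nonneg_right K1 ((sin_nonneg_of_nonneg_of_le_pi hw (by linarith only [hw, hw2, pi_gt_three])) : 0 ≤ sin w)
  have ee2 := abs_le.1 (exp_quad (1*w/5) (by rw [abs_le]; constructor <;> linarith only [hw, hw2]))
  have eb2 : |(1*w/5)| ^ 3 = w ^ 3 * (1/125) := by
    rw [show (1*w/5) = w * (1*1/5) by ring, abs_mul, mul_pow, abs_of_nonneg hw]
    norm_num [abs_of_pos, abs_of_neg]
  rw [eb2] at ee2
  have pp2 := exp_pos (1*w/5)
  have K2 : 8809/100 ≤ 245*c*E := by linarith only [hSs.1, hSs.2, hSc.1, hSc.2, hSX.1, hSX.2, hCs.1, hCs.2, hCc.1, hCc.2, hCX.1, hCX.2, hEs.1, hEs.2, hEc.1, hEc.2, hFX.1, hFX.2]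
  have L2 := mul_le_mul_of_nonneg_right K2 (pp2.le : 0 ≤ exp (1*w/5))
  have ee3 := abs_le.1 (exp_quad (-1*w/5) (by rw [abs_le]; constructor <;> linarith only [hw, hw2]))
  have eb3 : |(-1*w/5)| ^ 3 = w ^ 3 * (1/125) := by
    rw [show (-1*w/5) = w * (-1*1/5) by ring, abs_mul, mul_pow, abs_of_nonneg hw]
    norm_num [abs_of_pos, abs_of_neg]
  rw [eb3] at ee3
  have pp3 := exp_pos (-1*w/5)
  have K3 : 55677/100 ≤ 245*X*F := by linarith only [hSs.1, hSs.2, hSc.1, hSc.2, hSX.1, hSX.2, hCs.1, hCs.2, hCc.1, hCc.2, hCX.1, hCX.2, hEs.1, hEs.2, hEc.1, hEc.2, hFX.1, hFX.2]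
  have L3 := mul_le_mul_of_nonneg_right K3 (pp3.le : 0 ≤ exp (-1*w/5))
  clear hSs hSc hSX hCs hCc hCX hEs hEc hEX hFs hFc hFX
  obtain ⟨w2, w3, w4, w5⟩ := wpow w (2/5) hw hw2
  linarith [pow_nonneg hw 2, pow_nonneg hw 3, pow_nonneg hw 4, pow_nonneg hw 5, ee3.1, ee3.2, ee2.1, ee2.2]

lemma p4 (S C E F s c X w : ℝ) (hw : 0 ≤ w) (hw2 : w ≤ 2/5)
    (hS : |S - (-94526551/10^8)| ≤ 2/10^6) (hC : |C - (-32630218/10^8)| ≤ 2/10^6)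
    (hE : |E - (41644537/10^8)| ≤ 2/10^6) (hF : |F - (240127537/10^8)| ≤ 2/10^6)
    (hs : |s - (45288629/10^8)| ≤ 2/10^6) (hc : |c - (89156829/10^8)| ≤ 2/10^6)
    (hX : |X - (83840836/10^8)| ≤ 2/10^6) :
    ((385*c+1666*s-385*X)*S+(-245*c-245*X)*C)*cos w + (1*((385*c+1666*s-385*X)*C-(-245*c-245*X)*S))*sin w + (245*c*E)*exp (-1*w/5) + (245*X*F)*exp (1*w/5) < 0 := by
  have hSs := abs_le.1 (mulb hS hs (by norm_num [abs_le]) (by norm_num [abs_le]))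
  have hSc := abs_le.1 (mulb hS hc (by norm_num [abs_le]) (by norm_num [abs_le]))
  have hSX := abs_le.1 (mulb hS hX (by norm_num [abs_le]) (by norm_num [abs_le]))
  have hCs := abs_le.1 (mulb hC hs (by norm_num [abs_le]) (by norm_num [abs_le]))
  have hCc := abs_le.1 (mulb hC hc (by norm_num [abs_le]) (by norm_num [abs_le]))
  have hCX := abs_le.1 (mulb hC hX (by norm_num [abs_le]) (by norm_num [abs_le]))
  have hEs := abs_le.1 (mulb hE hs (by norm_num [abs_le]) (by norm_num [abs_le]))
  have hEc := abs_le.1 (mulb hE hc (by norm_num [abs_le]) (by norm_num [abs_le]))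
  have hEX := abs_le.1 (mulb hE hX (by norm_num [abs_le]) (by norm_num [abs_le]))
  have hFs := abs_le.1 (mulb hF hs (by norm_num [abs_le]) (by norm_num [abs_le]))
  have hFc := abs_le.1 (mulb hF hc (by norm_num [abs_le]) (by norm_num [abs_le]))
  have hFX := abs_le.1 (mulb hF hX (by norm_num [abs_le]) (by norm_num [abs_le]))
  clear hS hC hE hF hs hc hX
  have cw1 : 1 - w^2/2 ≤ cos w := one_sub_sq_div_two_le_cos
  have cw2 := cos_up4 w hw
  have sw1 := sin_ge_sub_cube hw
  have sw2 := sin_up5 w hw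
  have K0 : (385*c+1666*s-385*X)*S+(-245*c-245*X)*C ≤ -2971/5 := by linarith only [hSs.1, hSs.2, hSc.1, hSc.2, hSX.1, hSX.2, hCs.1, hCs.2, hCc.1, hCc.2, hCX.1, hCX.2, hEs.1, hEs.2, hEc.1, hEc.2, hFX.1, hFX.2]
  have L0 := mul_le_mul_of_nonneg_right K0 ((cos_nonneg_of_neg_pi_div_two_le_of_le (by linarith only [hw, hw2, pi_gt_three]) (by linarith only [hw, hw2, pi_gt_three])) : 0 ≤ cos w)
  have K1 : 1*((385*c+1666*s-385*X)*C-(-245*c-245*X)*S) ≤ -32673/50 := by linarith only [hSs.1, hSs.2, hSc.1, hSc.2, hSX.1, hSX.2, hCs.1, hCs.2, hCc.1, hCc.2, hCX.1, hCX.2, hEs.1, hEs.2, hEc.1, hEc.2, hFX.1, hFX.2]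
  have L1 := mul_le_mul_of_nonneg_right K1 ((sin_nonneg_of_nonneg_of_le_pi hw (by linarith only [hw, hw2, pi_gt_three])) : 0 ≤ sin w)
  have ee2 := abs_le.1 (exp_quad (-1*w/5) (by rw [abs_le]; constructor <;> linarith only [hw, hw2]))
  have eb2 : |(-1*w/5)| ^ 3 = w ^ 3 * (1/125) := by
    rw [show (-1*w/5) = w * (-1*1/5) by ring, abs_mul, mul_pow, abs_of_nonneg hw]
    norm_num [abs_of_pos, abs_of_neg]
  rw [eb2] at ee2
  have pp2 := exp_pos (-1*w/5)
  have K2 : 245*c*E ≤ 9103/100 := by linarith only [hSs.1, hSs.2, hSc.1, hSc.2, hSX.1, hSX.2, hCs.1, hCs.2, hCc.1, hCc.2, hCX.1, hCX.2, hEs.1, hEs.2, hEc.1, hEc.2, hFX.1, hFX.2]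
  have L2 := mul_le_mul_of_nonneg_right K2 (pp2.le : 0 ≤ exp (-1*w/5))
  have ee3 := abs_le.1 (exp_quad (1*w/5) (by rw [abs_le]; constructor <;> linarith only [hw, hw2]))
  have eb3 : |(1*w/5)| ^ 3 = w ^ 3 * (1/125) := by
    rw [show (1*w/5) = w * (1*1/5) by ring, abs_mul, mul_pow, abs_of_nonneg hw]
    norm_num [abs_of_pos, abs_of_neg]
  rw [eb3] at ee3
  have pp3 := exp_pos (1*w/5)
  have K3 : 245*X*F ≤ 49331/100 := by linarith only [hSs.1, hSs.2, hSc.1, hSc.2, hSX.1, hSX.2, hCs.1, hCs.2, hCc.1, hCc.2, hCX.1, hCX.2, hEs.1, hEs.2, hEc.1, hEc.2, hFX.1, hFX.2]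
  have L3 := mul_le_mul_of_nonneg_right K3 (pp3.le : 0 ≤ exp (1*w/5))
  clear hSs hSc hSX hCs hCc hCX hEs hEc hEX hFs hFc hFX
  obtain ⟨w2, w3, w4, w5⟩ := wpow w (2/5) hw hw2
  linarith [pow_nonneg hw 2, pow_nonneg hw 3, pow_nonneg hw 4, pow_nonneg hw 5, ee3.1, ee3.2, ee2.1, ee2.2]

/-- Sign conditions of the Poincaré–Miranda theorem on the box
`B₃ = [219/50, 239/50] × [9/25, 47/100]`. -/
theorem poincare_miranda_signs_B3 :
    (∀ v ∈ Set.Icc (9/25 : ℝ) (47/100), e1 (219/50) v < 0 ∧ 0 < e1 (239/50) v) ∧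
    (∀ u ∈ Set.Icc (219/50 : ℝ) (239/50), 0 < e2 u (9/25) ∧ e2 u (47/100) < 0) := by
  have hb : exp (-3 * (47/100) / 8) = exp (-(141/800)) := by norm_num
  have ha : exp (-3 * (9/25) / 8) = exp (-(27/200)) := by norm_num
  have h1 : exp (-(219/50) / 5) = exp (-(219/250)) := by norm_num
  have h2 : exp (-(239/50) / 5) = exp (-(239/250)) := by norm_num
  refine ⟨fun v hv => ⟨?_, ?_⟩, fun u hu => ⟨?_, ?_⟩⟩
  · have := p1 _ _ _ _ _ _ _ (47/100 - v) (by linarith [hv.2]) (by linarith [hv.1])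
      S1 C1 exp_m876 exp_p876 sin_b cos_b exp_b
    obtain ⟨w, rfl⟩ : ∃ w, v = 47/100 - w := ⟨47/100 - v, by ring⟩
    rw [show (47/100 - (47/100 - w) : ℝ) = w by ring] at this
    unfold e1
    rw [h1, sin_sub, cos_sub, show -3 * (47/100 - w) / 8 = -(141/800) + 3 * w / 8 by ring, exp_add]
    refine lt_of_eq_of_lt ?_ this
    ring
  · have := p2 _ _ _ _ _ _ _ (v - 9/25) (by linarith [hv.1]) (by linarith [hv.2])
      S2 C2 exp_m956 exp_p956 sin_a cos_a exp_a
    obtain ⟨w, rfl⟩ : ∃ w, v = 9/25 + w := ⟨v - 9/25, by ring⟩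
    rw [show (9/25 + w - 9/25 : ℝ) = w by ring] at this
    unfold e1
    rw [h2, sin_add, cos_add, show -3 * (9/25 + w) / 8 = -(27/200) + -3 * w / 8 by ring, exp_add]
    refine lt_of_lt_of_eq this ?_
    ring
  · have := p3 _ _ _ _ _ _ _ (239/50 - u) (by linarith [hu.2]) (by linarith [hu.1])
      S2 C2 exp_m956 exp_p956 sin_a cos_a exp_a
    obtain ⟨w, rfl⟩ : ∃ w, u = 239/50 - w := ⟨239/50 - u, by ring⟩
    rw [show (239/50 - (239/50 - w) : ℝ) = w by ring] at this
    unfold e2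
    rw [ha, sin_sub, cos_sub, show -(239/50 - w) / 5 = -(239/250) + 1 * w / 5 by ring,
      show (239/50 - w) / 5 = 239/250 + -1 * w / 5 by ring, exp_add, exp_add]
    refine lt_of_lt_of_eq this ?_
    ring
  · have := p4 _ _ _ _ _ _ _ (u - 219/50) (by linarith [hu.1]) (by linarith [hu.2])
      S1 C1 exp_m876 exp_p876 sin_b cos_b exp_b
    obtain ⟨w, rfl⟩ : ∃ w, u = 219/50 + w := ⟨u - 219/50, by ring⟩
    rw [show (219/50 + w - 219/50 : ℝ) = w by ring] at this
    unfold e2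
    rw [hb, sin_add, cos_add, show -(219/50 + w) / 5 = -(219/250) + -1 * w / 5 by ring,
      show (219/50 + w) / 5 = 219/250 + 1 * w / 5 by ring, exp_add, exp_add]
    refine lt_of_eq_of_lt ?_ this
    ring
end

section
/- Define e₁(u,v) = 1666 sin(u) cos(v) + (245(cos(u) − e^{−u/5}) − 385 sin(u)) sin(v) − 1666 sin(u) e^{−3v/8} and e₂(u,v) = (−245(cos(u) − e^{−u/5}) + 385 sin(u)) cos(v) + 1666 sin(u) sin(v) + (−385 sin(u) − 245 cos(u) + 245 e^{u/5}) e^{−3v/8}. Then there exists a point (u, v) in the open rectangle (139/40, 219/50) × (47/100, 7/5) with e₁(u, v) = 0 and e₂(u, v) = 0. -/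
open Real

lemma aux_dbl {x a b c d : ℝ} (ha : 0 ≤ a) (hc : 0 ≤ c) (h1 : a ≤ sin x) (h2 : sin x ≤ b)
    (h3 : c ≤ cos x) (h4 : cos x ≤ d) :
    2 * a * c ≤ sin (2 * x) ∧ sin (2 * x) ≤ 2 * b * d ∧ 1 - 2 * b ^ 2 ≤ cos (2 * x) ∧
      cos (2 * x) ≤ 1 - 2 * a ^ 2 := by
  have e : cos (2 * x) = 1 - 2 * sin x ^ 2 := by
    rw [cos_two_mul]; linarith [sin_sq_add_cos_sq x]
  rw [sin_two_mul, e]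
  have i1 : a * c ≤ sin x * cos x := mul_le_mul h1 h3 hc (by linarith)
  have i2 : sin x * cos x ≤ b * d := mul_le_mul h2 h4 (by linarith) (by linarith)
  have i3 : a ^ 2 ≤ sin x ^ 2 := pow_le_pow_left₀ ha h1 2
  have i4 : sin x ^ 2 ≤ b ^ 2 := pow_le_pow_left₀ (by linarith) h2 2
  refine ⟨?_, ?_, ?_, ?_⟩ <;> linarith

lemma aux_base {x : ℝ} (h0 : 0 ≤ x) (h1 : x ≤ 1) :
    x - x ^ 3 / 6 - x ^ 5 / 100 ≤ sin x ∧ sin x ≤ x - x ^ 3 / 6 + x ^ 5 / 100 ∧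
    1 - x ^ 2 / 2 - x ^ 4 * (5 / 96) ≤ cos x ∧ cos x ≤ 1 - x ^ 2 / 2 + x ^ 4 * (5 / 96) := by
  have hx : |x| = x := abs_of_nonneg h0
  have s := Real.sin_bound (x := x) (by rw [hx]; exact h1)
  have c := Real.cos_bound (x := x) (by rw [hx]; exact h1)
  rw [hx, abs_le] at s c
  refine ⟨?_, ?_, ?_, ?_⟩ <;> linarith [s.1, s.2, c.1, c.2]

lemma trig_101 : 0.8462 ≤ sin 1.01 ∧ cos 1.01 ≤ 0.5325 := by
  have h := aux_base (x := 1.01 / 8) (by norm_num) (by norm_num)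
  have k1 := aux_dbl (x := 1.01 / 8) (a := 0.12591) (b := 0.12592) (c := 0.99201) (d := 0.99206)
    (by norm_num) (by norm_num)
    (by linarith [h.1]) (by linarith [h.2.1]) (by linarith [h.2.2.1]) (by linarith [h.2.2.2])
  rw [show (2 : ℝ) * (1.01 / 8) = 1.01 / 4 by norm_num] at k1
  have k2 := aux_dbl (by norm_num) (by norm_num) k1.1 k1.2.1 k1.2.2.1 k1.2.2.2
  rw [show (2 : ℝ) * (1.01 / 4) = 1.01 / 2 by norm_num] at k2
  have k3 := aux_dbl (by norm_num) (by norm_num) k2.1 k2.2.1 k2.2.2.1 k2.2.2.2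
  rw [show (2 : ℝ) * (1.01 / 2) = 1.01 by norm_num] at k3
  constructor
  · linarith [k3.1]
  · linarith [k3.2.2.2]

lemma trig_54 : sin 0.54 ≤ 0.5142 ∧ 0.8576 ≤ cos 0.54 := by
  have h := aux_base (x := 0.54 / 8) (by norm_num) (by norm_num)
  have k1 := aux_dbl (by norm_num) (by norm_num) h.1 h.2.1 h.2.2.1 h.2.2.2
  rw [show (2 : ℝ) * (0.54 / 8) = 0.54 / 4 by norm_num] at k1
  have k2 := aux_dbl (by norm_num) (by norm_num) k1.1 k1.2.1 k1.2.2.1 k1.2.2.2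
  rw [show (2 : ℝ) * (0.54 / 4) = 0.54 / 2 by norm_num] at k2
  have k3 := aux_dbl (by norm_num) (by norm_num) k2.1 k2.2.1 k2.2.2.1 k2.2.2.2
  rw [show (2 : ℝ) * (0.54 / 2) = 0.54 by norm_num] at k3
  constructor
  · linarith [k3.2.1]
  · linarith [k3.2.2.1]

lemma exp_lo {x : ℝ} (h0 : 0 ≤ x) :
    1 + x + x ^ 2 / 2 + x ^ 3 / 6 + x ^ 4 / 24 + x ^ 5 / 120 + x ^ 6 / 720 ≤ exp x := by
  have := Real.sum_le_exp_of_nonneg h0 7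
  simp [Finset.sum_range_succ, Nat.factorial] at this
  linarith

lemma exp_hi {x : ℝ} (h0 : 0 ≤ x) (h1 : x ≤ 1) :
    exp x ≤ 1 + x + x ^ 2 / 2 + x ^ 3 / 6 + x ^ 4 / 24 + x ^ 5 / 120 + x ^ 6 / 720
      + x ^ 7 * 8 / (5040 * 7) := by
  have := Real.exp_bound' h0 h1 (n := 7) (by norm_num)
  simp [Finset.sum_range_succ, Nat.factorial] at this
  norm_num at this
  linarith

lemma exp_ge_of {y r x : ℝ} (h0 : 0 ≤ x) (hxy : x ≤ y)
    (h : r ≤ 1 + x + x ^ 2 / 2 + x ^ 3 / 6 + x ^ 4 / 24 + x ^ 5 / 120 + x ^ 6 / 720) :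
    r ≤ exp y := (h.trans (exp_lo h0)).trans (exp_le_exp.2 hxy)

lemma exp_le_of {y r x : ℝ} (h0 : 0 ≤ x) (h1 : x ≤ 1) (hxy : y ≤ x)
    (h : 1 + x + x ^ 2 / 2 + x ^ 3 / 6 + x ^ 4 / 24 + x ^ 5 / 120 + x ^ 6 / 720
      + x ^ 7 * 8 / (5040 * 7) ≤ r) :
    exp y ≤ r := ((exp_le_exp.2 hxy).trans (exp_hi h0 h1)).trans h

noncomputable def fA (u : ℝ) : ℝ := 245 * (cos u - exp (-u / 5)) - 385 * sin u
noncomputable def fB (u : ℝ) : ℝ := 1666 * sin u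
noncomputable def fC (u : ℝ) : ℝ := -385 * sin u - 245 * cos u + 245 * exp (u / 5)
noncomputable def fR (u : ℝ) : ℝ := (fB u ^ 2 + fC u ^ 2) / (fB u ^ 2 + fA u ^ 2)
noncomputable def fV (u : ℝ) : ℝ := 4 / 3 * log (fR u)
noncomputable def fH (u : ℝ) : ℝ :=
  cos (fV u) * (fB u * (fC u - fA u)) + sin (fV u) * (fA u * fC u + fB u ^ 2)

lemma inv_bd {u a b : ℝ} (ha : 0 < a) (h1 : a ≤ exp (u / 5)) (h2 : exp (u / 5) ≤ b) :
    1 / b ≤ exp (-u / 5) ∧ exp (-u / 5) ≤ 1 / a := by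
  rw [neg_div, exp_neg, inv_eq_one_div]
  have := exp_pos (u / 5)
  exact ⟨one_div_le_one_div_of_le this h2, one_div_le_one_div_of_le ha h1⟩

lemma sq3 : 1.73205 ≤ √3 ∧ √3 ≤ 1.73206 := by
  constructor
  · apply Real.le_sqrt_of_sq_le; norm_num
  · rw [Real.sqrt_le_left (by norm_num)]; norm_num

lemma sq2 : 1.4142 ≤ √2 ∧ √2 ≤ 1.4143 := by
  constructor
  · apply Real.le_sqrt_of_sq_le; norm_num
  · rw [Real.sqrt_le_left (by norm_num)]; norm_num

lemma coarse_alg {A B C : ℝ} (A1 : -138 ≤ A) (A2 : A ≤ 106) (B1 : -1443 ≤ B) (B2 : B ≤ -833)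
    (C1 : 824 ≤ C) (C2 : C ≤ 1113)
    (key : (-138 ≤ A ∧ A ≤ 106 ∧ -1179 ≤ B) ∨ (982 ≤ C ∧ -106 ≤ A)) :
    (B < 0 ∧ A < C ∧ 0 < A * C + B ^ 2) ∧
    1.42265 * (B ^ 2 + A ^ 2) < B ^ 2 + C ^ 2 ∧
    B ^ 2 + C ^ 2 < 2.857 * (B ^ 2 + A ^ 2) := by
  have hBsq : 833 ^ 2 ≤ B ^ 2 := by nlinarith
  have hCsq : C ^ 2 ≤ 1113 ^ 2 := by nlinarith
  have hA2 : A ^ 2 ≤ 138 ^ 2 := by nlinarith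
  refine ⟨⟨by linarith, by linarith, by nlinarith⟩, ?_, by nlinarith [sq_nonneg A]⟩
  rcases key with ⟨_, _, h⟩ | ⟨h, h'⟩
  · have : B ^ 2 ≤ 1179 ^ 2 := by nlinarith
    have : 824 ^ 2 ≤ C ^ 2 := by nlinarith
    linarith
  · have : B ^ 2 ≤ 1443 ^ 2 := by nlinarith
    have : 982 ^ 2 ≤ C ^ 2 := by nlinarith
    have : A ^ 2 ≤ 106 ^ 2 := by nlinarith
    linarith

/-- coarse bounds -/
lemma coarse {u : ℝ} (h1 : 7 * π / 6 ≤ u) (h2 : u ≤ 4 * π / 3) :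
    (fB u < 0 ∧ fA u < fC u ∧ 0 < fA u * fC u + fB u ^ 2) ∧
    1.42265 * (fB u ^ 2 + fA u ^ 2) < fB u ^ 2 + fC u ^ 2 ∧
    fB u ^ 2 + fC u ^ 2 < 2.857 * (fB u ^ 2 + fA u ^ 2) := by
  have p1 := Real.pi_gt_d4
  have p2 := Real.pi_lt_d4
  have t3 := sq3
  have t2 := sq2
  obtain ⟨x, rfl⟩ : ∃ x, u = x + π := ⟨u - π, by ring⟩
  have s1 : 1 / 2 ≤ sin x := by
    rw [← sin_pi_div_six]; apply sin_le_sin_of_le_of_le_pi_div_two <;> linarith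
  have s2 : sin x ≤ √3 / 2 := by
    rw [← sin_pi_div_three]; apply sin_le_sin_of_le_of_le_pi_div_two <;> linarith
  have c1 : 1 / 2 ≤ cos x := by
    rw [← cos_pi_div_three]; apply cos_le_cos_of_nonneg_of_le_pi <;> linarith
  have c2 : cos x ≤ √3 / 2 := by
    rw [← cos_pi_div_six]; apply cos_le_cos_of_nonneg_of_le_pi <;> linarith
  have e1 : 2.08 ≤ exp ((x + π) / 5) :=
    exp_ge_of (x := 0.733) (by norm_num) (by linarith) (by norm_num)
  have e2 : exp ((x + π) / 5) ≤ 2.312 :=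
    exp_le_of (x := 0.838) (by norm_num) (by norm_num) (by linarith) (by norm_num)
  have e3 := inv_bd (by norm_num) e1 e2
  have hB : fB (x + π) = -1666 * sin x := by simp [fB]
  have hA : fA (x + π) = 245 * (-cos x - exp (-(x + π) / 5)) + 385 * sin x := by
    simp [fA]
  have hC : fC (x + π) = 385 * sin x + 245 * cos x + 245 * exp ((x + π) / 5) := by
    simp [fC]
  have A1 : -138 ≤ fA (x + π) := by rw [hA]; linarith [e3.2]
  have A2 : fA (x + π) ≤ 106 := by rw [hA]; linarith [e3.1]
  have B1 : -1443 ≤ fB (x + π) := by rw [hB]; linarith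
  have B2 : fB (x + π) ≤ -833 := by rw [hB]; linarith
  have C1 : 824 ≤ fC (x + π) := by rw [hC]; linarith
  have C2 : fC (x + π) ≤ 1113 := by rw [hC]; linarith
  have key : (-138 ≤ fA (x + π) ∧ fA (x + π) ≤ 106 ∧ -1179 ≤ fB (x + π)) ∨
      (982 ≤ fC (x + π) ∧ -106 ≤ fA (x + π)) := by
    rcases le_total x (π / 4) with h | h
    · left
      have : sin x ≤ √2 / 2 := by
        rw [← sin_pi_div_four]; apply sin_le_sin_of_le_of_le_pi_div_two <;> linarith
      refine ⟨A1, A2, ?_⟩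
      rw [hB]; linarith
    · right
      have s3 : √2 / 2 ≤ sin x := by
        rw [← sin_pi_div_four]; apply sin_le_sin_of_le_of_le_pi_div_two <;> linarith
      have c3 : cos x ≤ √2 / 2 := by
        rw [← cos_pi_div_four]; apply cos_le_cos_of_nonneg_of_le_pi <;> linarith
      have e4 : 2.192 ≤ exp ((x + π) / 5) :=
        exp_ge_of (x := 0.785) (by norm_num) (by linarith) (by norm_num)
      have q1 : 0 ≤ (sin x - 0.7071) * (0.86603 - sin x) :=
        mul_nonneg (by linarith) (by linarith)
      have q2 : 0 ≤ (cos x - 0.5) * (0.70715 - cos x) :=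
        mul_nonneg (by linarith) (by linarith)
      have q3 := sin_sq_add_cos_sq x
      constructor
      · rw [hC]; nlinarith
      · rw [hA]; linarith [e3.2]
  exact coarse_alg A1 A2 B1 B2 C1 C2 key

lemma fV_bd {u : ℝ} (h1 : 7 * π / 6 ≤ u) (h2 : u ≤ 4 * π / 3) :
    0.47 < fV u ∧ fV u < 1.4 ∧ 0 < fR u := by
  obtain ⟨⟨hB, -, -⟩, r1, r2⟩ := coarse h1 h2
  have hp : 0 < fB u ^ 2 + fA u ^ 2 := by have := hB.ne; positivity
  have R1 : 1.42265 < fR u := by rw [fR, lt_div_iff₀ hp]; exact r1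
  have R2 : fR u < 2.857 := by rw [fR, div_lt_iff₀ hp]; exact r2
  have R0 : 0 < fR u := by linarith
  have l1 : 0.3525 < log (fR u) := by
    rw [lt_log_iff_exp_lt R0]
    exact (exp_le_of (x := 0.3525) (by norm_num) (by norm_num) le_rfl (by norm_num)).trans_lt R1
  have l2 : log (fR u) < 1.05 := by
    rw [log_lt_iff_lt_exp R0]
    exact R2.trans_le (exp_ge_of (x := 1.05) (by norm_num) le_rfl (by norm_num))
  refine ⟨?_, ?_, R0⟩ <;> rw [fV] <;> linarith

lemma H_left : 0 ≤ fH (7 * π / 6) := by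
  have p1 := Real.pi_gt_d4
  have p2 := Real.pi_lt_d4
  have t3 := sq3
  obtain ⟨⟨hB0, hAC, hM⟩, -, -⟩ := coarse (u := 7 * π / 6) le_rfl (by linarith)
  obtain ⟨v1, v2, R0⟩ := fV_bd (u := 7 * π / 6) le_rfl (by linarith)
  have e1 : 2.081 ≤ exp ((7 * π / 6) / 5) :=
    exp_ge_of (x := 0.733) (by norm_num) (by linarith) (by norm_num)
  have e2 : exp ((7 * π / 6) / 5) ≤ 2.0815 :=
    exp_le_of (x := 0.73304) (by norm_num) (by norm_num) (by linarith) (by norm_num)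
  have e3 := inv_bd (by norm_num) e1 e2
  have hs : sin (7 * π / 6) = -(1 / 2) := by
    rw [show 7 * π / 6 = π / 6 + π by ring, sin_add_pi, sin_pi_div_six]
  have hc : cos (7 * π / 6) = -(√3 / 2) := by
    rw [show 7 * π / 6 = π / 6 + π by ring, cos_add_pi, cos_pi_div_six]
  have hB : fB (7 * π / 6) = -833 := by rw [fB, hs]; norm_num
  have A1 : -137.5 ≤ fA (7 * π / 6) := by rw [fA, hs, hc]; linarith [e3.2]
  have A2 : fA (7 * π / 6) ≤ -137.3 := by rw [fA, hs, hc]; linarith [e3.1]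
  have C1 : 914.5 ≤ fC (7 * π / 6) := by rw [fC, hs, hc]; linarith
  have C2 : fC (7 * π / 6) ≤ 914.7 := by rw [fC, hs, hc]; linarith
  have hV : 1.01 ≤ fV (7 * π / 6) := by
    have : 0.7575 ≤ log (fR (7 * π / 6)) := by
      rw [le_log_iff_exp_le R0]
      refine (exp_le_of (r := 2.1335) (x := 0.7575) (by norm_num) (by norm_num) le_rfl
        (by norm_num)).trans ?_
      rw [fR, hB, le_div_iff₀ (by positivity)]
      nlinarith
    rw [fV]; linarith
  obtain ⟨ts, tc⟩ := trig_101
  have hsv : 0.8462 ≤ sin (fV (7 * π / 6)) :=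
    ts.trans (sin_le_sin_of_le_of_le_pi_div_two (by linarith) (by linarith) hV)
  have hcv : cos (fV (7 * π / 6)) ≤ 0.5325 :=
    (cos_le_cos_of_nonneg_of_le_pi (by norm_num) (by linarith) hV).trans tc
  rw [fH]
  have m1 : 0.8462 * (fA (7 * π / 6) * fC (7 * π / 6) + fB (7 * π / 6) ^ 2) ≤
    sin (fV (7 * π / 6)) * (fA (7 * π / 6) * fC (7 * π / 6) + fB (7 * π / 6) ^ 2) :=
    mul_le_mul_of_nonneg_right hsv hM.le
  have m2 : 0.5325 * (fB (7 * π / 6) * (fC (7 * π / 6) - fA (7 * π / 6))) ≤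
     cos (fV (7 * π / 6)) * (fB (7 * π / 6) * (fC (7 * π / 6) - fA (7 * π / 6))) :=
    mul_le_mul_of_nonpos_right hcv (mul_nonpos_of_nonpos_of_nonneg hB0.le (by linarith))
  rw [hB] at *
  nlinarith

lemma H_right : fH (4 * π / 3) ≤ 0 := by
  have p1 := Real.pi_gt_d4
  have p2 := Real.pi_lt_d4
  have t3 := sq3
  obtain ⟨⟨hB0, hAC, hM⟩, -, -⟩ := coarse (u := 4 * π / 3) (by linarith) le_rfl
  obtain ⟨v1, v2, R0⟩ := fV_bd (u := 4 * π / 3) (by linarith) le_rfl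
  have e1 : 2.311 ≤ exp ((4 * π / 3) / 5) :=
    exp_ge_of (x := 0.83773) (by norm_num) (by linarith) (by norm_num)
  have e2 : exp ((4 * π / 3) / 5) ≤ 2.3113 :=
    exp_le_of (x := 0.83776) (by norm_num) (by norm_num) (by linarith) (by norm_num)
  have e3 := inv_bd (by norm_num) e1 e2
  have hs : sin (4 * π / 3) = -(√3 / 2) := by
    rw [show 4 * π / 3 = π / 3 + π by ring, sin_add_pi, sin_pi_div_three]
  have hc : cos (4 * π / 3) = -(1 / 2) := by
    rw [show 4 * π / 3 = π / 3 + π by ring, cos_add_pi, cos_pi_div_three]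
  have B1 : -1442.81 ≤ fB (4 * π / 3) := by rw [fB, hs]; linarith
  have B2 : fB (4 * π / 3) ≤ -1442.79 := by rw [fB, hs]; linarith
  have A1 : 104.88 ≤ fA (4 * π / 3) := by rw [fA, hs, hc]; linarith [e3.2]
  have A2 : fA (4 * π / 3) ≤ 104.94 := by rw [fA, hs, hc]; linarith [e3.1]
  have C1 : 1022.1 ≤ fC (4 * π / 3) := by rw [fC, hs, hc]; linarith
  have C2 : fC (4 * π / 3) ≤ 1022.2 := by rw [fC, hs, hc]; linarith
  obtain ⟨ts, tc⟩ := trig_54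
  have hV : fV (4 * π / 3) ≤ 0.54 := by
    have : log (fR (4 * π / 3)) ≤ 0.405 := by
      rw [log_le_iff_le_exp R0]
      refine le_trans ?_ (exp_ge_of (r := 1.499) (x := 0.405) (by norm_num) le_rfl
        (by norm_num))
      have hBne := hB0.ne
      rw [fR, div_le_iff₀ (by positivity)]
      have : 1442.79 ^ 2 ≤ fB (4 * π / 3) ^ 2 := by nlinarith
      have : fC (4 * π / 3) ^ 2 ≤ 1022.2 ^ 2 := by nlinarith
      have : 104.88 ^ 2 ≤ fA (4 * π / 3) ^ 2 := by nlinarith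
      linarith
    rw [fV]; linarith
  have hsv : sin (fV (4 * π / 3)) ≤ 0.5142 :=
    (sin_le_sin_of_le_of_le_pi_div_two (by linarith) (by linarith) hV).trans ts
  have hcv : 0.8576 ≤ cos (fV (4 * π / 3)) :=
    tc.trans (cos_le_cos_of_nonneg_of_le_pi (by linarith) (by linarith) hV)
  rw [fH]
  generalize sin (fV (4 * π / 3)) = s at *
  generalize cos (fV (4 * π / 3)) = c at *
  generalize fA (4 * π / 3) = A at *
  generalize fB (4 * π / 3) = B at *
  generalize fC (4 * π / 3) = C at *
  have m1 : s * (A * C + B ^ 2) ≤ 0.5142 * (A * C + B ^ 2) :=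
    mul_le_mul_of_nonneg_right hsv hM.le
  have m2 : c * (B * (C - A)) ≤ 0.8576 * (B * (C - A)) :=
    mul_le_mul_of_nonpos_right hcv (mul_nonpos_of_nonpos_of_nonneg hB0.le (by linarith))
  have m3 : B ^ 2 ≤ 1442.81 ^ 2 := by nlinarith
  have m4 : A * C ≤ 104.94 * 1022.2 := by nlinarith
  have m5 : B * (C - A) ≤ -1442.79 * 917.16 := by nlinarith
  linarith

lemma H_cont : ContinuousOn fH (Set.Icc (7 * π / 6) (4 * π / 3)) := by
  have cA : Continuous fA := by unfold fA; fun_prop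
  have cB : Continuous fB := by unfold fB; fun_prop
  have cC : Continuous fC := by unfold fC; fun_prop
  have cR : ContinuousOn fR (Set.Icc (7 * π / 6) (4 * π / 3)) := by
    unfold fR
    apply ContinuousOn.div (by fun_prop) (by fun_prop)
    intro u hu
    have := (coarse hu.1 hu.2).1.1.ne
    positivity
  have cV : ContinuousOn fV (Set.Icc (7 * π / 6) (4 * π / 3)) := by
    unfold fV
    exact continuousOn_const.mul (cR.log fun u hu => (fV_bd hu.1 hu.2).2.2.ne')
  unfold fH
  exact ((continuous_cos.comp_continuousOn cV).mul (by fun_prop)).add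
    ((continuous_sin.comp_continuousOn cV).mul (by fun_prop))

/-- Existence of a common zero of `e₁, e₂` in the open box
`(139/40, 219/50) × (47/100, 7/5)`, giving the second of the three limit cycles. -/
theorem common_zero_B2 :
    ∃ u v : ℝ, u ∈ Set.Ioo (139/40 : ℝ) (219/50) ∧ v ∈ Set.Ioo (47/100 : ℝ) (7/5) ∧
      e1 u v = 0 ∧ e2 u v = 0 := by
  have p1 := Real.pi_gt_d4
  have p2 := Real.pi_lt_d4
  obtain ⟨u, ⟨hu1, hu2⟩, hu⟩ := intermediate_value_Icc' (by linarith) H_cont ⟨H_right, H_left⟩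
  obtain ⟨⟨hB, hAC, hM⟩, -, -⟩ := coarse hu1 hu2
  obtain ⟨v1, v2, R0⟩ := fV_bd hu1 hu2
  refine ⟨u, fV u, ⟨by linarith, by linarith⟩, ⟨by linarith, by linarith⟩, ?_⟩
  have hBne := hB.ne
  have hE2 : exp (-3 * fV u / 8) ^ 2 * (fB u ^ 2 + fC u ^ 2) = fB u ^ 2 + fA u ^ 2 := by
    have : exp (-3 * fV u / 8) ^ 2 = (fR u)⁻¹ := by
      rw [← exp_nat_mul, fV, show ((2 : ℕ) : ℝ) * (-3 * (4 / 3 * log (fR u)) / 8) = -log (fR u) by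
        push_cast; ring, exp_neg, exp_log R0]
    rw [this, fR]
    have : 0 < fB u ^ 2 + fA u ^ 2 := by positivity
    have : 0 < fB u ^ 2 + fC u ^ 2 := by positivity
    field_simp
  have hE := exp_pos (-3 * fV u / 8)
  have hs : 0 < sin (fV u) := sin_pos_of_pos_of_lt_pi (by linarith) (by linarith)
  have hc : 0 < cos (fV u) := cos_pos_of_mem_Ioo ⟨by linarith, by linarith⟩
  have hsc := sin_sq_add_cos_sq (fV u)
  have g1 : e1 u (fV u) = fB u * cos (fV u) + fA u * sin (fV u)
      - fB u * exp (-3 * fV u / 8) := by simp only [e1, fA, fB]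
  have g2 : e2 u (fV u) = fB u * sin (fV u) - fA u * cos (fV u)
      + fC u * exp (-3 * fV u / 8) := by simp only [e2, fA, fB, fC]; ring
  rw [g1, g2]
  rw [fH] at hu
  generalize exp (-3 * fV u / 8) = E at *
  generalize sin (fV u) = s at *
  generalize cos (fV u) = c at *
  generalize fA u = A at *
  generalize fB u = B at *
  generalize fC u = C at *
  have hD : 0 < B ^ 2 + C ^ 2 := by positivity
  obtain ⟨t, ht⟩ : ∃ t, t * (B ^ 2 + C ^ 2) = c * (A * C + B ^ 2) + s * (B * (A - C)) :=
    ⟨_, div_mul_cancel₀ _ hD.ne'⟩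
  have htp : 0 < t := by
    have : 0 < t * (B ^ 2 + C ^ 2) := by
      rw [ht]
      have := mul_pos hc hM
      have := mul_pos hs (mul_pos_of_neg_of_neg hB (sub_neg.2 hAC))
      linarith
    exact pos_of_mul_pos_left this hD.le
  have hX : B * c + A * s = t * B := by
    apply mul_right_cancel₀ hD.ne'
    linear_combination (-B) * ht + C * hu
  have hY : B * s - A * c = -(t * C) := by
    apply mul_right_cancel₀ hD.ne'
    linear_combination C * ht + B * hu
  have hsq : t ^ 2 * (B ^ 2 + C ^ 2) = E ^ 2 * (B ^ 2 + C ^ 2) := by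
    rw [hE2]
    linear_combination (-(B * c + A * s) - t * B) * hX - (B * s - A * c - t * C) * hY
      + (A ^ 2 + B ^ 2) * hsc
  have htE : t = E := by
    have := mul_right_cancel₀ hD.ne' hsq
    exact (pow_left_inj₀ htp.le hE.le two_ne_zero).1 this
  subst htE
  constructor <;> linarith
end

section
/- Define e₁(u,v) = 1666 sin(u) cos(v) + (245(cos(u) − e^{−u/5}) − 385 sin(u)) sin(v) − 1666 sin(u) e^{−3v/8} and e₂(u,v) = (−245(cos(u) − e^{−u/5}) + 385 sin(u)) cos(v) + 1666 sin(u) sin(v) + (−385 sin(u) − 245 cos(u) + 245 e^{u/5}) e^{−3v/8}. Then there exists a point (u, v) in the open rectangle (219/50, 239/50) × (9/25, 47/100) with e₁(u, v) = 0 and e₂(u, v) = 0. -/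
open Real

theorem nonneg_of_der (f f' : ℝ → ℝ) (h0 : f 0 = 0) (hd : ∀ x, HasDerivAt f (f' x) x)
    (hp : ∀ x, 0 ≤ x → 0 ≤ f' x) (x : ℝ) (hx : 0 ≤ x) : 0 ≤ f x := by
  have : MonotoneOn f (Set.Ici 0) := by
    apply monotoneOn_of_deriv_nonneg (convex_Ici 0)
    · exact fun y _ => (hd y).continuousAt.continuousWithinAt
    · exact fun y _ => (hd y).differentiableAt.differentiableWithinAt
    · intro y hy
      rw [interior_Ici] at hy
      rw [(hd y).deriv]
      exact hp y (le_of_lt hy)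
  have := this (Set.mem_Ici.2 le_rfl) (Set.mem_Ici.2 hx) hx
  linarith

theorem cos_up (x : ℝ) (hx : 0 ≤ x) : cos x ≤ 1 - x^2/2 + x^4/24 := by
  have := nonneg_of_der (fun x => 1 - x^2/2 + x^4/24 - cos x) (fun x => sin x - (x - x^3/6))
    (by simp) (by
      intro x
      have h := ((((hasDerivAt_const x (1:ℝ)).sub ((hasDerivAt_pow 2 x).div_const 2)).add
        ((hasDerivAt_pow 4 x).div_const 24)).sub (hasDerivAt_cos x))
      exact h.congr_deriv (by push_cast; ring))
    (fun x hx => by have := Real.sin_ge_sub_cube hx; linarith) x hx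
  linarith

theorem sin_up (x : ℝ) (hx : 0 ≤ x) : sin x ≤ x - x^3/6 + x^5/120 := by
  have := nonneg_of_der (fun x => x - x^3/6 + x^5/120 - sin x)
    (fun x => (1 - x^2/2 + x^4/24) - cos x)
    (by simp) (by
      intro x
      have h := ((((hasDerivAt_id' x).sub ((hasDerivAt_pow 3 x).div_const 6)).add
        ((hasDerivAt_pow 5 x).div_const 120)).sub (hasDerivAt_sin x))
      exact h.congr_deriv (by push_cast; ring))
    (fun x hx => by have := cos_up x hx; linarith) x hx
  linarith

theorem cos_lo (x : ℝ) (hx : 0 ≤ x) : 1 - x^2/2 + x^4/24 - x^6/720 ≤ cos x := by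
  have := nonneg_of_der (fun x => cos x - (1 - x^2/2 + x^4/24 - x^6/720))
    (fun x => (x - x^3/6 + x^5/120) - sin x)
    (by simp) (by
      intro x
      have h := (hasDerivAt_cos x).sub ((((hasDerivAt_const x (1:ℝ)).sub
        ((hasDerivAt_pow 2 x).div_const 2)).add
        ((hasDerivAt_pow 4 x).div_const 24)).sub ((hasDerivAt_pow 6 x).div_const 720))
      exact h.congr_deriv (by push_cast; ring))
    (fun x hx => by have := sin_up x hx; linarith) x hx
  linarith

theorem exp_near (x : ℝ) (h : |x| ≤ 1) :
    |exp x - (1 + x + x^2/2 + x^3/6 + x^4/24 + x^5/120 + x^6/720 + x^7/5040)|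
      ≤ |x|^8 * (9/(40320*8)) := by
  have := Real.exp_bound h (n := 8) (by norm_num)
  simp [Finset.sum_range_succ, Nat.factorial] at this
  norm_num at this ⊢
  exact this

/-- exp bounds -/
theorem expP : 2.5658 ≤ exp (3*π/10) ∧ exp (3*π/10) ≤ 2.5668 := by
  have h1 : exp (589/625) ≤ exp (3*π/10) := exp_le_exp.2 (by have := pi_gt_d4; linarith)
  have h2 : exp (3*π/10) ≤ exp (11781/12500) := exp_le_exp.2 (by have := pi_lt_d4; linarith)
  have h3 := abs_le.1 (exp_near (589/625) (by norm_num [abs_le]))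
  have h4 := abs_le.1 (exp_near (11781/12500) (by norm_num [abs_le]))
  rw [abs_of_nonneg (by norm_num)] at h3 h4
  norm_num at h3 h4 ⊢
  constructor <;> linarith

theorem expN : 0.3895 ≤ exp (-(3*π/10)) ∧ exp (-(3*π/10)) ≤ 0.3898 := by
  obtain ⟨h1, h2⟩ := expP
  rw [exp_neg]
  have hp := exp_pos (3*π/10)
  constructor
  · rw [le_inv_comm₀ (by norm_num) hp]; exact h2.trans (by norm_num)
  · rw [inv_le_comm₀ hp (by norm_num)]; exact le_trans (by norm_num) h1

theorem exp_near_neg (x : ℝ) (h0 : 0 ≤ x) (h : x ≤ 1/5) :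
    1 - x + x^2/2 - x^3/6 - 1/10^4 ≤ exp (-x) ∧ exp (-x) ≤ 1 - x + x^2/2 - x^3/6 + 1/10^4 := by
  have h1 := Real.exp_bound (x := -x) (by rw [abs_le]; constructor <;> linarith) (n := 4) (by norm_num)
  simp [Finset.sum_range_succ, Nat.factorial] at h1
  rw [abs_of_nonneg h0] at h1
  have h2 : x^4 ≤ (1/5)^4 := pow_le_pow_left₀ h0 h 4
  have h1 := abs_le.1 h1
  norm_num at h1 h2 ⊢
  have e3 : (-x)^3 = - x^3 := by ring
  rw [e3] at h1
  constructor <;> linarith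

theorem implicit_ivt (f g : ℝ → ℝ → ℝ) (hf : Continuous (fun p : ℝ × ℝ => f p.1 p.2))
    (hg : Continuous (fun p : ℝ × ℝ => g p.1 p.2)) (c d a b : ℝ) (hcd : c ≤ d) (hab : a < b)
    (hm : ∀ u ∈ Set.Icc c d, StrictMonoOn (f u) (Set.Icc a b))
    (ha : ∀ u ∈ Set.Icc c d, f u a < 0) (hb : ∀ u ∈ Set.Icc c d, 0 < f u b)
    (hc : ∀ v ∈ Set.Ioo a b, f c v = 0 → g c v ≤ 0)
    (hd : ∀ v ∈ Set.Ioo a b, f d v = 0 → 0 ≤ g d v) :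
    ∃ u ∈ Set.Icc c d, ∃ v ∈ Set.Ioo a b, f u v = 0 ∧ g u v = 0 := by
  have hv : ∀ u, ∃ v, u ∈ Set.Icc c d → (v ∈ Set.Ioo a b ∧ f u v = 0) := by
    intro u
    by_cases hu : u ∈ Set.Icc c d
    · have hcu : Continuous (f u) := by
        exact hf.comp (Continuous.prodMk continuous_const continuous_id)
      obtain ⟨v, hv, h⟩ := intermediate_value_Ioo hab.le hcu.continuousOn
        (show (0:ℝ) ∈ Set.Ioo (f u a) (f u b) from ⟨ha u hu, hb u hu⟩)
      exact ⟨v, fun _ => ⟨hv, h⟩⟩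
    · exact ⟨0, fun h => absurd h hu⟩
  choose v hv using hv
  have hfu : ∀ p, Continuous (fun u => f u p) := fun p =>
    hf.comp (Continuous.prodMk continuous_id continuous_const)
  have hcont : ContinuousOn v (Set.Icc c d) := by
    intro u hu
    obtain ⟨hvu, hz⟩ := hv u hu
    refine tendsto_order.2 ⟨fun p hp => ?_, fun p hp => ?_⟩
    · by_cases hpa : p < a
      · filter_upwards [self_mem_nhdsWithin] with w hw
        exact hpa.trans (hv w hw).1.1
      · push Not at hpa
        have hpI : p ∈ Set.Icc a b := ⟨hpa, (hp.trans hvu.2).le⟩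
        have h1 : f u p < 0 := by
          rw [← hz]; exact hm u hu hpI ⟨hvu.1.le, hvu.2.le⟩ hp
        have h2 := (hfu p).continuousWithinAt (s := Set.Icc c d) (x := u) |>.eventually_lt_const h1
        filter_upwards [self_mem_nhdsWithin, h2] with w hw hw2
        obtain ⟨hvw, hzw⟩ := hv w hw
        rw [← hzw] at hw2
        exact ((hm w hw).lt_iff_lt hpI ⟨hvw.1.le, hvw.2.le⟩).1 hw2
    · by_cases hpa : b < p
      · filter_upwards [self_mem_nhdsWithin] with w hw
        exact (hv w hw).1.2.trans hpa
      · push Not at hpa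
        have hpI : p ∈ Set.Icc a b := ⟨(hvu.1.trans hp).le, hpa⟩
        have h1 : 0 < f u p := by
          rw [← hz]; exact hm u hu ⟨hvu.1.le, hvu.2.le⟩ hpI hp
        have h2 := (hfu p).continuousWithinAt (s := Set.Icc c d) (x := u) |>.eventually_const_lt h1
        filter_upwards [self_mem_nhdsWithin, h2] with w hw hw2
        obtain ⟨hvw, hzw⟩ := hv w hw
        rw [← hzw] at hw2
        exact ((hm w hw).lt_iff_lt ⟨hvw.1.le, hvw.2.le⟩ hpI).1 hw2
  have hG : ContinuousOn (fun u => g u (v u)) (Set.Icc c d) :=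
    hg.comp_continuousOn (continuousOn_id.prodMk hcont)
  have hcI : c ∈ Set.Icc c d := ⟨le_rfl, hcd⟩
  have hdI : d ∈ Set.Icc c d := ⟨hcd, le_rfl⟩
  obtain ⟨u, hu, h⟩ := intermediate_value_Icc hcd hG
    (show (0:ℝ) ∈ Set.Icc _ _ from ⟨hc _ (hv c hcI).1 (hv c hcI).2, hd _ (hv d hdI).1 (hv d hdI).2⟩)
  exact ⟨u, hu, v u, (hv u hu).1, (hv u hu).2, h⟩

/-- e1 in shifted variable -/
theorem e1_shift (t v : ℝ) : e1 (3*π/2 + t) v =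
    cos t * (1666 * (exp (-(3*v/8)) - cos v) + 385 * sin v)
      + 245 * (sin t - exp (-(3*π/10)) * exp (-(t/5))) * sin v := by
  have h1 : sin (3*π/2 + t) = - cos t := by
    rw [show 3*π/2 + t = t + π/2 + π by ring, sin_add_pi, sin_add_pi_div_two]
  have h2 : cos (3*π/2 + t) = sin t := by
    rw [show 3*π/2 + t = t + π/2 + π by ring, cos_add_pi, cos_add_pi_div_two]; ring
  rw [e1, h1, h2, ← exp_add, show -(3*π/2+t)/5 = -(3*π/10) + -(t/5) by ring,
    show -3*v/8 = -(3*v/8) by ring]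
  ring

theorem e2_shift (t v : ℝ) : e2 (3*π/2 + t) v =
    -((245 * (sin t - exp (-(3*π/10)) * exp (-(t/5))) + 385 * cos t) * cos v
      + 1666 * cos t * sin v)
    + (385 * cos t - 245 * sin t + 245 * (exp (3*π/10) * exp (t/5))) * exp (-(3*v/8)) := by
  have h1 : sin (3*π/2 + t) = - cos t := by
    rw [show 3*π/2 + t = t + π/2 + π by ring, sin_add_pi, sin_add_pi_div_two]
  have h2 : cos (3*π/2 + t) = sin t := by
    rw [show 3*π/2 + t = t + π/2 + π by ring, cos_add_pi, cos_add_pi_div_two]; ring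
  rw [e2, h1, h2, ← exp_add, ← exp_add, show -(3*π/2+t)/5 = -(3*π/10) + -(t/5) by ring,
    show (3*π/2+t)/5 = 3*π/10 + t/5 by ring,
    show -3*v/8 = -(3*v/8) by ring]
  ring

theorem mono_aux : MonotoneOn (fun v : ℝ => exp (-(3*v/8)) - cos v) (Set.Icc (9/25) (47/100)) := by
  have hd : ∀ v : ℝ, HasDerivAt (fun v : ℝ => exp (-(3*v/8)) - cos v)
      (sin v - 3/8 * exp (-(3*v/8))) v := by
    intro v
    have h := ((((hasDerivAt_id' v).const_mul 3).div_const 8).neg.exp).sub (hasDerivAt_cos v)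
    exact h.congr_deriv (by simp only [Pi.neg_apply]; ring)
  apply monotoneOn_of_deriv_nonneg (convex_Icc _ _)
  · exact fun y _ => (hd y).continuousAt.continuousWithinAt
  · exact fun y _ => (hd y).differentiableAt.differentiableWithinAt
  · intro y hy
    rw [interior_Icc] at hy
    rw [(hd y).deriv]
    obtain ⟨h1, h2⟩ := hy
    have a1 : exp (-(3*y/8)) ≤ exp (-(27/200)) := exp_le_exp.2 (by linarith)
    have a2 := (exp_near_neg (27/200) (by norm_num) (by norm_num)).2
    have a3 : sin (9/25) ≤ sin y := by
      apply sin_le_sin_of_le_of_le_pi_div_two <;> linarith [pi_gt_three]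
    have a4 := Real.sin_ge_sub_cube (x := 9/25) (by norm_num)
    norm_num at a2 a4
    linarith

theorem mono_aux2 (A B : ℝ) (hA : 0 ≤ A) (hA2 : A ≤ 400) (hB : 1500 ≤ B) :
    MonotoneOn (fun v : ℝ => A * cos v + B * sin v) (Set.Icc (9/25) (47/100)) := by
  have hd : ∀ v : ℝ, HasDerivAt (fun v : ℝ => A * cos v + B * sin v)
      (A * (-sin v) + B * cos v) v := by
    intro v
    exact ((hasDerivAt_cos v).const_mul A).add ((hasDerivAt_sin v).const_mul B)
  apply monotoneOn_of_deriv_nonneg (convex_Icc _ _)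
  · exact fun y _ => (hd y).continuousAt.continuousWithinAt
  · exact fun y _ => (hd y).differentiableAt.differentiableWithinAt
  · intro y hy
    rw [interior_Icc] at hy
    rw [(hd y).deriv]
    obtain ⟨h1, h2⟩ := hy
    have a1 := Real.one_sub_sq_div_two_le_cos (x := y)
    have a2 := Real.sin_le_one y
    have a3 : 1/2 ≤ cos y := by nlinarith
    nlinarith

theorem e2_anti (t v w : ℝ) (hv : v ∈ Set.Icc (9/25 : ℝ) (47/100)) (hw : w ∈ Set.Icc (9/25 : ℝ) (47/100))
    (hvw : v ≤ w)
    (hA : 0 ≤ 245 * (sin t - exp (-(3*π/10)) * exp (-(t/5))) + 385 * cos t)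
    (hA2 : 245 * (sin t - exp (-(3*π/10)) * exp (-(t/5))) + 385 * cos t ≤ 400)
    (hB : 1500 ≤ 1666 * cos t)
    (hC : 0 ≤ 385 * cos t - 245 * sin t + 245 * (exp (3*π/10) * exp (t/5))) :
    e2 (3*π/2 + t) w ≤ e2 (3*π/2 + t) v := by
  rw [e2_shift, e2_shift]
  have h1 := mono_aux2 _ _ hA hA2 hB hv hw hvw
  have h2 : exp (-(3*w/8)) ≤ exp (-(3*v/8)) := exp_le_exp.2 (by linarith)
  have h3 := mul_le_mul_of_nonneg_left h2 hC
  simp only at h1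
  linarith

theorem trig_t (t : ℝ) (h : t ∈ Set.Icc (-1/4 : ℝ) 0) :
    -1/4 ≤ sin t ∧ sin t ≤ 0 ∧ 31/32 ≤ cos t ∧ cos t ≤ 1 ∧ 1 ≤ exp (-(t/5)) ∧
      exp (-(t/5)) ≤ 1.06 := by
  obtain ⟨h1, h2⟩ := h
  refine ⟨?_, ?_, ?_, cos_le_one t, ?_, ?_⟩
  · have := Real.sin_le (x := -t) (by linarith)
    rw [sin_neg] at this; linarith
  · exact sin_nonpos_of_nonpos_of_neg_pi_le h2 (by linarith [pi_gt_three])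
  · have := Real.one_sub_sq_div_two_le_cos (x := t)
    nlinarith
  · exact one_le_exp (by linarith)
  · have a : exp (-(t/5)) ≤ exp (1/20) := exp_le_exp.2 (by linarith)
    have h3 := abs_le.1 (exp_near (1/20) (by norm_num [abs_le]))
    rw [abs_of_nonneg (by norm_num)] at h3
    norm_num at h3 ⊢
    linarith

theorem A_pos (t : ℝ) (h : t ∈ Set.Icc (-1/4 : ℝ) 0) :
    100 ≤ 245 * (sin t - exp (-(3*π/10)) * exp (-(t/5))) + 385 * cos t ∧
    245 * (sin t - exp (-(3*π/10)) * exp (-(t/5))) + 385 * cos t ≤ 400 := by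
  obtain ⟨h1, h2, h3, h4, h5, h6⟩ := trig_t t h
  obtain ⟨q1, q2⟩ := expN
  have := mul_pos (exp_pos (-(3*π/10))) (exp_pos (-(t/5)))
  norm_num at q1 q2 h6
  constructor <;> nlinarith

theorem e1_mono (t : ℝ) (h : t ∈ Set.Icc (-1/4 : ℝ) 0) :
    StrictMonoOn (fun v => e1 (3*π/2 + t) v) (Set.Icc (9/25) (47/100)) := by
  intro v hv w hw hvw
  simp only [e1_shift]
  have h1 := mono_aux hv hw hvw.le
  have h2 : sin v < sin w := by
    apply sin_lt_sin_of_lt_of_le_pi_div_two _ _ hvw <;>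
      linarith [pi_gt_three, hv.1, hw.2]
  have h3 := mul_lt_mul_of_pos_left h2 (lt_of_lt_of_le (by norm_num) (A_pos t h).1)
  have h4 := mul_le_mul_of_nonneg_left h1 (show 0 ≤ 1666 * cos t by linarith [(trig_t t h).2.2.1])
  simp only at h4
  linarith

/-- values at a point v -/
theorem vals (v : ℝ) (h0 : 0 ≤ v) (h1 : v ≤ 1/2) :
    v - v^3/6 ≤ sin v ∧ sin v ≤ v - v^3/6 + v^5/120 ∧
    1 - v^2/2 + v^4/24 - v^6/720 ≤ cos v ∧ cos v ≤ 1 - v^2/2 + v^4/24 ∧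
    1 - (3*v/8) + (3*v/8)^2/2 - (3*v/8)^3/6 - 1/10^4 ≤ exp (-(3*v/8)) ∧
    exp (-(3*v/8)) ≤ 1 - (3*v/8) + (3*v/8)^2/2 - (3*v/8)^3/6 + 1/10^4 :=
  ⟨Real.sin_ge_sub_cube h0, sin_up v h0, cos_lo v h0, cos_up v h0,
   (exp_near_neg _ (by linarith) (by linarith)).1, (exp_near_neg _ (by linarith) (by linarith)).2⟩

/-- monotonicity of e1 in t -/
theorem e1_mono_t (v : ℝ) (hK : 0 ≤ 1666 * (exp (-(3*v/8)) - cos v) + 385 * sin v)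
    (hs : 0 ≤ sin v) (s t : ℝ) (hs' : -1/4 ≤ s) (hst : s ≤ t) (ht : t ≤ 0) :
    e1 (3*π/2 + s) v ≤ e1 (3*π/2 + t) v := by
  rw [e1_shift, e1_shift]
  have h1 : cos s ≤ cos t := by
    rw [← cos_neg s, ← cos_neg t]
    apply cos_le_cos_of_nonneg_of_le_pi <;> linarith [pi_gt_three]
  have h2 : sin s ≤ sin t := by
    apply sin_le_sin_of_le_of_le_pi_div_two <;> linarith [pi_gt_three]
  have h3 : exp (-(t/5)) ≤ exp (-(s/5)) := exp_le_exp.2 (by linarith)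
  have h4 := mul_le_mul_of_nonneg_left h3 (exp_pos (-(3*π/10))).le
  have h5 := mul_le_mul_of_nonneg_right h1 hK
  have h6 : (sin s - exp (-(3*π/10)) * exp (-(s/5))) * sin v
    ≤ (sin t - exp (-(3*π/10)) * exp (-(t/5))) * sin v :=
    mul_le_mul_of_nonneg_right (by linarith) hs
  linarith

theorem e1_36 (t : ℝ) (h : t ∈ Set.Icc (-1/4 : ℝ) 0) : e1 (3*π/2 + t) (9/25) < 0 := by
  obtain ⟨s1, s2, c1, c2, x1, x2⟩ := vals (9/25) (by norm_num) (by norm_num)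
  obtain ⟨q1, q2⟩ := expN
  norm_num at s1 s2 c1 c2 x1 x2 q1 q2
  refine lt_of_le_of_lt (e1_mono_t _ ?_ ?_ t 0 h.1 h.2 le_rfl) ?_
  · norm_num; linarith
  · linarith
  · rw [e1_shift]
    norm_num
    nlinarith [mul_nonneg (sub_nonneg.2 q1) (sub_nonneg.2 s1)]

theorem quarter : 0.2473 ≤ sin (1/4) ∧ sin (1/4) ≤ 0.2475 ∧ 0.9689 ≤ cos (1/4) ∧ cos (1/4) ≤ 0.96892
    ∧ 1.0512 ≤ exp (1/20) ∧ exp (1/20) ≤ 1.0513 := by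
  obtain ⟨s1, s2, c1, c2, x1, x2⟩ := vals (1/4) (by norm_num) (by norm_num)
  have h3 := abs_le.1 (exp_near (1/20) (by norm_num [abs_le]))
  rw [abs_of_nonneg (by norm_num)] at h3
  norm_num at *
  refine ⟨?_, ?_, ?_, ?_, ?_, ?_⟩ <;> linarith

theorem QG : 0.4094 ≤ exp (-(3*π/10)) * exp (1/20) ∧ exp (-(3*π/10)) * exp (1/20) ≤ 0.4098 := by
  obtain ⟨-, -, -, -, g1, g2⟩ := quarter
  obtain ⟨q1, q2⟩ := expN
  norm_num at *
  constructor <;> nlinarith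

theorem e1_quarter (v : ℝ) : e1 (3*π/2 + -1/4) v =
    cos (1/4) * (1666 * (exp (-(3*v/8)) - cos v) + 385 * sin v)
      - 245 * ((sin (1/4) + exp (-(3*π/10)) * exp (1/20)) * sin v) := by
  rw [e1_shift, show (-1/4 : ℝ) = -(1/4) by norm_num, cos_neg, sin_neg,
    show -(-(1/4 : ℝ)/5) = 1/20 by norm_num]
  ring

theorem e1_47 (t : ℝ) (h : t ∈ Set.Icc (-1/4 : ℝ) 0) : 0 < e1 (3*π/2 + t) (47/100) := by
  obtain ⟨s1, s2, c1, c2, x1, x2⟩ := vals (47/100) (by norm_num) (by norm_num)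
  obtain ⟨q1, q2⟩ := QG
  obtain ⟨a1, a2, b1, b2, -, -⟩ := quarter
  norm_num at s1 s2 c1 c2 x1 x2 q1 q2 a1 a2 b1 b2
  refine lt_of_lt_of_le ?_ (e1_mono_t _ ?_ ?_ (-1/4) t le_rfl h.1 h.2)
  · rw [e1_quarter]
    norm_num
    set K := 1666 * (exp (-(141/800)) - cos (47/100)) + 385 * sin (47/100) with hK
    have k1 : 84 ≤ K := by linarith
    set R := sin (1/4) + exp (-(3*π/10)) * exp (1/20) with hR
    have r2 : R ≤ 0.6573 := by norm_num; linarith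
    have r3 : R * sin (47/100) ≤ 0.6573 * 0.453 := by
      apply mul_le_mul r2 _ _ (by norm_num) <;> norm_num <;> linarith
    nlinarith
  · norm_num; linarith
  · linarith

theorem p1_s19 : e1 (3*π/2 + -1/4) (11/25) < 0 := by
  obtain ⟨s1, s2, c1, c2, x1, x2⟩ := vals (11/25) (by norm_num) (by norm_num)
  obtain ⟨q1, q2⟩ := QG
  obtain ⟨a1, a2, b1, b2, -, -⟩ := quarter
  norm_num at s1 s2 c1 c2 x1 x2 q1 q2 a1 a2 b1 b2
  rw [e1_quarter]
  norm_num
  set K := 1666 * (exp (-(33/200)) - cos (11/25)) + 385 * sin (11/25) with hK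
  have k1 : K ≤ 70.1 := by norm_num; linarith
  set R := sin (1/4) + exp (-(3*π/10)) * exp (1/20) with hR
  have r2 : 0.6567 ≤ R := by norm_num; linarith
  have r3 : 0.6567 * 0.4258 ≤ R * sin (11/25) := by
    apply mul_le_mul r2 _ (by norm_num) (by linarith); norm_num; linarith
  norm_num at r3 k1
  nlinarith

theorem p2_s19 : e2 (3*π/2 + -1/4) (11/25) < 0 := by
  obtain ⟨s1, s2, c1, c2, x1, x2⟩ := vals (11/25) (by norm_num) (by norm_num)
  obtain ⟨q1, q2⟩ := QG
  obtain ⟨p1_s19, p2_s19⟩ := expP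
  obtain ⟨y1, y2⟩ := exp_near_neg (1/20) (by norm_num) (by norm_num)
  obtain ⟨a1, a2, b1, b2, -, -⟩ := quarter
  norm_num at s1 s2 c1 c2 x1 x2 q1 q2 a1 a2 b1 b2 p1_s19 p2_s19 y1 y2
  rw [e2_shift, show (-1/4 : ℝ) = -(1/4) by norm_num, cos_neg, sin_neg,
    show -(-(1/4 : ℝ)/5) = 1/20 by norm_num]
  norm_num
  have z : exp (3*π/10) * exp (-(1/20)) ≤ 6417/2500 * 0.95135 := by
    apply mul_le_mul p2_s19 _ (exp_pos _).le (by norm_num); norm_num; linarith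
  set A := 245 * (-sin (1/4) - exp (-(3*π/10)) * exp (1/20)) + 385 * cos (1/4) with hA
  have A1 : 211.9 ≤ A := by norm_num; linarith
  set C := 385 * cos (1/4) + 245 * sin (1/4) + 245 * (exp (3*π/10) * exp (-(1/20))) with hC
  have C2 : C ≤ 1032.1 := by norm_num at z ⊢; linarith
  have m1 : 211.9 * 0.9047 ≤ A * cos (11/25) := by
    apply mul_le_mul A1 _ (by norm_num) (by linarith); norm_num; linarith
  have m2 : 0.9689 * 0.4258 ≤ cos (1/4) * sin (11/25) := by
    apply mul_le_mul _ _ (by norm_num) (by linarith) <;> norm_num <;> linarith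
  have m3 : C * exp (-(33/200)) ≤ 1032.1 * 0.848 := by
    apply mul_le_mul C2 _ (exp_pos _).le (by norm_num); norm_num; linarith
  norm_num at m1 m2 m3
  linarith

theorem p3_s19 : 0 < e1 (3*π/2 + 0) (37/100) := by
  obtain ⟨s1, s2, c1, c2, x1, x2⟩ := vals (37/100) (by norm_num) (by norm_num)
  obtain ⟨q1, q2⟩ := expN
  norm_num at s1 s2 c1 c2 x1 x2 q1 q2
  rw [e1_shift]
  norm_num
  have : exp (-(3*π/10)) * sin (37/100) ≤ 0.3898 * 0.3617 := by
    apply mul_le_mul _ _ _ (by norm_num) <;> norm_num <;> linarith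
  norm_num at this
  linarith

theorem p4_s19 : 0 < e2 (3*π/2 + 0) (37/100) := by
  obtain ⟨s1, s2, c1, c2, x1, x2⟩ := vals (37/100) (by norm_num) (by norm_num)
  obtain ⟨q1, q2⟩ := expN
  obtain ⟨p1_s19, p2_s19⟩ := expP
  norm_num at s1 s2 c1 c2 x1 x2 q1 q2 p1_s19 p2_s19
  rw [e2_shift]
  norm_num
  have m1 : 0.3895 * 0.932 ≤ exp (-(3*π/10)) * cos (37/100) := by
    apply mul_le_mul _ _ (by norm_num) (exp_pos _).le <;> norm_num <;> linarith
  have m2 : 2.5658 * 0.8702 ≤ exp (3*π/10) * exp (-(111/800)) := by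
    apply mul_le_mul _ _ (by norm_num) (exp_pos _).le <;> norm_num <;> linarith
  norm_num at m1 m2
  linarith

theorem e1_cont : Continuous (fun p : ℝ × ℝ => e1 (3*π/2 + p.1) p.2) := by
  unfold e1; fun_prop

theorem e2_cont : Continuous (fun p : ℝ × ℝ => e2 (3*π/2 + p.1) p.2) := by
  unfold e2; fun_prop

theorem C_pos (t : ℝ) (h : t ∈ Set.Icc (-1/4 : ℝ) 0) :
    0 ≤ 385 * cos t - 245 * sin t + 245 * (exp (3*π/10) * exp (t/5)) := by
  obtain ⟨h1, h2, h3, h4, h5, h6⟩ := trig_t t h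
  have := mul_pos (exp_pos (3*π/10)) (exp_pos (t/5))
  linarith

/-- Existence of a common zero of `e₁, e₂` in the open box
`(219/50, 239/50) × (9/25, 47/100)`, giving the third of the three limit cycles. -/
theorem common_zero_B3 :
    ∃ u v : ℝ, u ∈ Set.Ioo (219/50 : ℝ) (239/50) ∧ v ∈ Set.Ioo (9/25 : ℝ) (47/100) ∧
      e1 u v = 0 ∧ e2 u v = 0 := by
  have hB : ∀ t ∈ Set.Icc (-1/4 : ℝ) 0, 1500 ≤ 1666 * cos t := fun t ht => by
    linarith [(trig_t t ht).2.2.1]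
  have m0 : (-1/4 : ℝ) ∈ Set.Icc (-1/4 : ℝ) 0 := by constructor <;> norm_num
  have m1 : (0 : ℝ) ∈ Set.Icc (-1/4 : ℝ) 0 := by constructor <;> norm_num
  have w0 : (11/25 : ℝ) ∈ Set.Icc (9/25 : ℝ) (47/100) := by constructor <;> norm_num
  have w1 : (37/100 : ℝ) ∈ Set.Icc (9/25 : ℝ) (47/100) := by constructor <;> norm_num
  obtain ⟨t, ht, v, hv, h1, h2⟩ := implicit_ivt (fun t v => e1 (3*π/2 + t) v)
    (fun t v => e2 (3*π/2 + t) v) e1_cont e2_cont (-1/4) 0 (9/25) (47/100) (by norm_num)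
    (by norm_num) e1_mono e1_36 e1_47
    (by
      intro v hv h
      have hv' : v ∈ Set.Icc (9/25 : ℝ) (47/100) := ⟨hv.1.le, hv.2.le⟩
      have hlt : (11/25 : ℝ) < v := by
        refine ((e1_mono _ m0).lt_iff_lt w0 hv').1 ?_
        rw [h]; exact p1_s19
      have hA := A_pos _ m0
      exact (e2_anti _ _ _ w0 hv' hlt.le (by linarith [hA.1]) hA.2 (hB _ m0) (C_pos _ m0)).trans p2_s19.le)
    (by
      intro v hv h
      have hv' : v ∈ Set.Icc (9/25 : ℝ) (47/100) := ⟨hv.1.le, hv.2.le⟩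
      have hlt : v < (37/100 : ℝ) := by
        refine ((e1_mono _ m1).lt_iff_lt hv' w1).1 ?_
        rw [h]; exact p3_s19
      have hA := A_pos _ m1
      exact p4_s19.le.trans
        (e2_anti _ _ _ hv' w1 hlt.le (by linarith [hA.1]) hA.2 (hB _ m1) (C_pos _ m1)))
  refine ⟨3*π/2 + t, v, ⟨?_, ?_⟩, hv, h1, h2⟩
  · linarith [pi_gt_d2, ht.1]
  · linarith [pi_lt_d2, ht.2]
end
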